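/- Let A be a Koszul algebra with quadratic relation space I₂, let B be a free algebra generated in degree 1, and suppose τ: B⊗A → A⊗B is a separable graded twisting map satisfying π_{A₀⊗A₂⊗B₁}(1⊗τ)(τ_B⊗1)(B₁⊗I₂) = 0. Then A⊗_τB is Koszul. -/

import Mathlib

open TensorProduct

noncomputable section

namespace TTP

variable (𝕜 : Type) [Field 𝕜]

/-- The image of `p ⊗ q` inside `M ⊗[𝕜] N`, for submodules `p ⊆ M`, `q ⊆ N`. -/
def subTmul {M N : Type} [AddCommGroup M] [Module 𝕜 M] [AddCommGroup N] [Module 𝕜 N]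
    (p : Submodule 𝕜 M) (q : Submodule 𝕜 N) : Submodule 𝕜 (M ⊗[𝕜] N) :=
  LinearMap.range (TensorProduct.map p.subtype q.subtype)

/-- The Künneth grading on a tensor product of graded vector spaces. -/
def kunneth {M N : Type} [AddCommGroup M] [Module 𝕜 M] [AddCommGroup N] [Module 𝕜 N]
    (𝒜 : ℕ → Submodule 𝕜 M) (ℬ : ℕ → Submodule 𝕜 N) (n : ℕ) : Submodule 𝕜 (M ⊗[𝕜] N) :=
  ⨆ (pq : ℕ × ℕ) (_ : pq.1 + pq.2 = n), subTmul 𝕜 (𝒜 pq.1) (ℬ pq.2)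

/-- The positive part `X₊ = ⊕_{i>0} X_i` of a graded vector space. -/
def plusPart {M : Type} [AddCommGroup M] [Module 𝕜 M] (𝒜 : ℕ → Submodule 𝕜 M) :
    Submodule 𝕜 M :=
  ⨆ (i : ℕ) (_ : 0 < i), 𝒜 i

/-- The grading concentrating `𝒜 1` in degree `1` (and `⊥` elsewhere). -/
def degOne {M : Type} [AddCommGroup M] [Module 𝕜 M] (𝒜 : ℕ → Submodule 𝕜 M) :
    ℕ → Submodule 𝕜 M :=
  fun n => if n = 1 then 𝒜 1 else ⊥

variable (A B : Type) [Ring A] [Algebra 𝕜 A] [Ring B] [Algebra 𝕜 B]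

/-- `τ ∘ (μ_B ⊗ μ_A)` on `(B ⊗ B) ⊗ (A ⊗ A)`. -/
def twistLHS (τ : B ⊗[𝕜] A →ₗ[𝕜] A ⊗[𝕜] B) :
    (B ⊗[𝕜] B) ⊗[𝕜] (A ⊗[𝕜] A) →ₗ[𝕜] A ⊗[𝕜] B :=
  τ ∘ₗ TensorProduct.map (LinearMap.mul' 𝕜 B) (LinearMap.mul' 𝕜 A)

/-- `(μ_A ⊗ μ_B) ∘ (1_A ⊗ τ ⊗ 1_B) ∘ (τ ⊗ τ) ∘ (1_B ⊗ τ ⊗ 1_A)` on `(B ⊗ B) ⊗ (A ⊗ A)`. -/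
def twistRHS (τ : B ⊗[𝕜] A →ₗ[𝕜] A ⊗[𝕜] B) :
    (B ⊗[𝕜] B) ⊗[𝕜] (A ⊗[𝕜] A) →ₗ[𝕜] A ⊗[𝕜] B :=
  TensorProduct.map (LinearMap.mul' 𝕜 A) (LinearMap.mul' 𝕜 B)
    ∘ₗ (TensorProduct.assoc 𝕜 A A (B ⊗[𝕜] B)).symm.toLinearMap
    ∘ₗ LinearMap.lTensor A (TensorProduct.assoc 𝕜 A B B).toLinearMap
    ∘ₗ LinearMap.lTensor A (LinearMap.rTensor B τ)
    ∘ₗ LinearMap.lTensor A (TensorProduct.assoc 𝕜 B A B).symm.toLinearMap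
    ∘ₗ (TensorProduct.assoc 𝕜 A B (A ⊗[𝕜] B)).toLinearMap
    ∘ₗ TensorProduct.map τ τ
    ∘ₗ (TensorProduct.assoc 𝕜 B A (B ⊗[𝕜] A)).symm.toLinearMap
    ∘ₗ LinearMap.lTensor B (TensorProduct.assoc 𝕜 A B A).toLinearMap
    ∘ₗ LinearMap.lTensor B (LinearMap.rTensor A τ)
    ∘ₗ LinearMap.lTensor B (TensorProduct.assoc 𝕜 B A A).symm.toLinearMap
    ∘ₗ (TensorProduct.assoc 𝕜 B B (A ⊗[𝕜] A)).toLinearMap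

/-- `τ : B ⊗ A → A ⊗ B` is an (algebra) twisting map: it satisfies the unital twisting
conditions and `τ(μ_B ⊗ μ_A) = (μ_A ⊗ μ_B)(1_A ⊗ τ ⊗ 1_B)(τ ⊗ τ)(1_B ⊗ τ ⊗ 1_A)`. -/
def IsTwisting (τ : B ⊗[𝕜] A →ₗ[𝕜] A ⊗[𝕜] B) : Prop :=
  (∀ a : A, τ ((1 : B) ⊗ₜ[𝕜] a) = a ⊗ₜ[𝕜] (1 : B)) ∧
  (∀ b : B, τ (b ⊗ₜ[𝕜] (1 : A)) = (1 : A) ⊗ₜ[𝕜] b) ∧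
  twistLHS 𝕜 A B τ = twistRHS 𝕜 A B τ

/-- `τ` preserves the Künneth grading. -/
def IsGradedMapBA (𝒜 : ℕ → Submodule 𝕜 A) (ℬ : ℕ → Submodule 𝕜 B)
    (τ : B ⊗[𝕜] A →ₗ[𝕜] A ⊗[𝕜] B) : Prop :=
  ∀ n, Submodule.map τ (kunneth 𝕜 ℬ 𝒜 n) ≤ kunneth 𝕜 𝒜 ℬ n

/-- `τ` is a graded twisting map. -/
def IsGradedTwisting (𝒜 : ℕ → Submodule 𝕜 A) (ℬ : ℕ → Submodule 𝕜 B)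
    (τ : B ⊗[𝕜] A →ₗ[𝕜] A ⊗[𝕜] B) : Prop :=
  IsTwisting 𝕜 A B τ ∧ IsGradedMapBA 𝕜 A B 𝒜 ℬ τ

/-- A graded linear map `τ` is graded twisting to degree `n`:  it satisfies the unital
conditions and the twisting identity in all (Künneth) degrees `≤ n`. -/
def TwistingToDeg (𝒜 : ℕ → Submodule 𝕜 A) (ℬ : ℕ → Submodule 𝕜 B)
    (τ : B ⊗[𝕜] A →ₗ[𝕜] A ⊗[𝕜] B) (n : ℕ) : Prop :=
  IsGradedMapBA 𝕜 A B 𝒜 ℬ τ ∧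
  (∀ j ≤ n, ∀ a ∈ 𝒜 j, τ ((1 : B) ⊗ₜ[𝕜] a) = a ⊗ₜ[𝕜] (1 : B)) ∧
  (∀ j ≤ n, ∀ b ∈ ℬ j, τ (b ⊗ₜ[𝕜] (1 : A)) = (1 : A) ⊗ₜ[𝕜] b) ∧
  (∀ j ≤ n, ∀ x ∈ kunneth 𝕜 (kunneth 𝕜 ℬ ℬ) (kunneth 𝕜 𝒜 𝒜) j,
    twistLHS 𝕜 A B τ x = twistRHS 𝕜 A B τ x)

/-- The unique extension property of a graded twisting map:  for every `n ≥ 3`, any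
linear map `τ'` that is graded twisting to degree `n` and agrees with `τ` in all degrees
`< n` also agrees with `τ` in degree `n`. -/
def UEP (𝒜 : ℕ → Submodule 𝕜 A) (ℬ : ℕ → Submodule 𝕜 B)
    (τ : B ⊗[𝕜] A →ₗ[𝕜] A ⊗[𝕜] B) : Prop :=
  ∀ n, 3 ≤ n → ∀ τ' : B ⊗[𝕜] A →ₗ[𝕜] A ⊗[𝕜] B,
    TwistingToDeg 𝕜 A B 𝒜 ℬ τ' n →
    (∀ i < n, ∀ x ∈ kunneth 𝕜 ℬ 𝒜 i, τ' x = τ x) →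
    ∀ x ∈ kunneth 𝕜 ℬ 𝒜 n, τ' x = τ x

/-- The multiplication `μ_τ = (μ_A ⊗ μ_B)(1_A ⊗ τ ⊗ 1_B)` on `A ⊗ B`. -/
def mulTau (τ : B ⊗[𝕜] A →ₗ[𝕜] A ⊗[𝕜] B) :
    (A ⊗[𝕜] B) ⊗[𝕜] (A ⊗[𝕜] B) →ₗ[𝕜] A ⊗[𝕜] B :=
  TensorProduct.map (LinearMap.mul' 𝕜 A) (LinearMap.mul' 𝕜 B)
    ∘ₗ (TensorProduct.assoc 𝕜 A A (B ⊗[𝕜] B)).symm.toLinearMap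
    ∘ₗ LinearMap.lTensor A (TensorProduct.assoc 𝕜 A B B).toLinearMap
    ∘ₗ LinearMap.lTensor A (LinearMap.rTensor B τ)
    ∘ₗ LinearMap.lTensor A (TensorProduct.assoc 𝕜 B A B).symm.toLinearMap
    ∘ₗ (TensorProduct.assoc 𝕜 A B (A ⊗[𝕜] B)).toLinearMap

/-- `(C, ψ)` realizes the twisted tensor product algebra `A ⊗_τ B`:  `ψ` is a linear
isomorphism carrying the multiplication `μ_τ` and its unit to those of `C`. -/
def Realizes (τ : B ⊗[𝕜] A →ₗ[𝕜] A ⊗[𝕜] B) (C : Type) [Ring C] [Algebra 𝕜 C]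
    (ψ : A ⊗[𝕜] B →ₗ[𝕜] C) : Prop :=
  Function.Bijective ψ ∧ ψ ((1 : A) ⊗ₜ[𝕜] (1 : B)) = 1 ∧
  ∀ x y : A ⊗[𝕜] B, ψ (mulTau 𝕜 A B τ (x ⊗ₜ[𝕜] y)) = ψ x * ψ y

/-- The two-sided ideal generated by a subset, as a `𝕜`-submodule. -/
def idealSpan (C : Type) [Ring C] [Algebra 𝕜 C] (s : Set C) : Submodule 𝕜 C :=
  Submodule.span 𝕜 {x | ∃ c d r, r ∈ s ∧ x = c * r * d}

/-- Weight grading of the tensor algebra. -/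
def tensorWeight (V : Type) [AddCommGroup V] [Module 𝕜 V] (n : ℕ) :
    Submodule 𝕜 (TensorAlgebra 𝕜 V) :=
  LinearMap.range (TensorAlgebra.ι 𝕜 (M := V)) ^ n

instance (V : Type) [AddCommGroup V] [Module 𝕜 V] : GradedAlgebra (tensorWeight 𝕜 V) :=
  inferInstanceAs (GradedAlgebra
    ((LinearMap.range (TensorAlgebra.ι 𝕜 : V →ₗ[𝕜] TensorAlgebra 𝕜 V) ^ ·) : ℕ → Submodule 𝕜 _))

/-- The canonical map `T(C₁) → C` for a graded algebra `C`. -/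
def canMap (C : Type) [Ring C] [Algebra 𝕜 C] (𝒞 : ℕ → Submodule 𝕜 C) :
    TensorAlgebra 𝕜 ↥(𝒞 1) →ₐ[𝕜] C :=
  TensorAlgebra.lift 𝕜 (𝒞 1).subtype

/-- `C` (with grading `𝒞`) is a quadratic algebra: the canonical map `T(C₁) → C` is
surjective and its kernel is generated, as a two-sided ideal, by its degree 2 part. -/
def IsQuadraticAlg (C : Type) [Ring C] [Algebra 𝕜 C] (𝒞 : ℕ → Submodule 𝕜 C) : Prop :=
  Function.Surjective (canMap 𝕜 C 𝒞) ∧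
  LinearMap.ker (canMap 𝕜 C 𝒞).toLinearMap =
    idealSpan 𝕜 (TensorAlgebra 𝕜 ↥(𝒞 1))
      ((LinearMap.ker (canMap 𝕜 C 𝒞).toLinearMap ⊓ tensorWeight 𝕜 ↥(𝒞 1) 2 : Submodule 𝕜 _) : Set _)

/-- The left ideal generated by the positive part of a graded algebra. -/
def augIdeal (C : Type) [Ring C] [Algebra 𝕜 C] (𝒞 : ℕ → Submodule 𝕜 C) : Submodule C C :=
  Submodule.span C {x : C | ∃ i, 0 < i ∧ x ∈ 𝒞 i}

/-- The degree `n` component of the graded free module on generators `σ` in degree `i`. -/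
def freeGrade (C : Type) [Ring C] [Algebra 𝕜 C] (𝒞 : ℕ → Submodule 𝕜 C)
    (i : ℕ) (σ : Type) (n : ℕ) : Submodule 𝕜 (σ →₀ C) :=
  ⨅ (j : σ), Submodule.comap (Finsupp.lapply j : (σ →₀ C) →ₗ[𝕜] C)
    (if i ≤ n then 𝒞 (n - i) else ⊥)

/-- `C` (with grading `𝒞`) is a Koszul algebra: the trivial module `𝕜 = C/C₊` admits a
resolution by graded free modules with the `i`-th term generated in degree `i`. -/
def IsKoszul (C : Type) [Ring C] [Algebra 𝕜 C] (𝒞 : ℕ → Submodule 𝕜 C) : Prop :=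
  ∃ (σ : ℕ → Type) (d : ∀ i : ℕ, ((σ (i + 1)) →₀ C) →ₗ[C] ((σ i) →₀ C))
    (ε : ((σ 0) →₀ C) →ₗ[C] (C ⧸ augIdeal 𝕜 C 𝒞)),
    Function.Surjective ε ∧
    LinearMap.ker ε = LinearMap.range (d 0) ∧
    (∀ i, LinearMap.ker (d i) = LinearMap.range (d (i + 1))) ∧
    (∀ i n, ∀ x ∈ freeGrade 𝕜 C 𝒞 (i + 1) (σ (i + 1)) n, d i x ∈ freeGrade 𝕜 C 𝒞 i (σ i) n) ∧
    (∀ n, 0 < n → ∀ x ∈ freeGrade 𝕜 C 𝒞 0 (σ 0) n, ε x = 0)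

/-- `(P, ιA, ιB)` is a free product (coproduct) of `A` and `B`. -/
def IsFreeProduct (P : Type) [Ring P] [Algebra 𝕜 P] (ιA : A →ₐ[𝕜] P) (ιB : B →ₐ[𝕜] P) :
    Prop :=
  ∀ (C : Type) [Ring C] [Algebra 𝕜 C], ∀ (f : A →ₐ[𝕜] C) (g : B →ₐ[𝕜] C),
    ∃! h : P →ₐ[𝕜] C, h.comp ιA = f ∧ h.comp ιB = g

/-- The linear map `A ⊗ B → P`, `a ⊗ b ↦ ιA(a) · ιB(b)`. -/
def mulMapP (P : Type) [Ring P] [Algebra 𝕜 P] (ιA : A →ₐ[𝕜] P) (ιB : B →ₐ[𝕜] P) :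
    A ⊗[𝕜] B →ₗ[𝕜] P :=
  TensorProduct.lift (LinearMap.mk₂ 𝕜 (fun a b => ιA a * ιB b)
    (fun a a' b => by simp [map_add, add_mul])
    (fun c a b => by simp [map_smul, smul_mul_assoc])
    (fun a b b' => by simp [map_add, mul_add])
    (fun c a b => by simp [map_smul, mul_smul_comm]))

/-- The set of `τ`-relations `b ⊗ a - τ(b ⊗ a)` of total degree at most `n`,
inside the free product `P`. -/
def relSetLe (P : Type) [Ring P] [Algebra 𝕜 P] (ιA : A →ₐ[𝕜] P) (ιB : B →ₐ[𝕜] P)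
    (𝒜 : ℕ → Submodule 𝕜 A) (ℬ : ℕ → Submodule 𝕜 B)
    (τ : B ⊗[𝕜] A →ₗ[𝕜] A ⊗[𝕜] B) (n : ℕ) : Set P :=
  {x | ∃ i j a b, i + j ≤ n ∧ a ∈ 𝒜 i ∧ b ∈ ℬ j ∧
    x = ιB b * ιA a - mulMapP 𝕜 A B P ιA ιB (τ (b ⊗ₜ[𝕜] a))}

/-- The set of all `τ`-relations `b ⊗ a - τ(b ⊗ a)` inside the free product `P`. -/
def relSetAll (P : Type) [Ring P] [Algebra 𝕜 P] (ιA : A →ₐ[𝕜] P) (ιB : B →ₐ[𝕜] P)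
    (τ : B ⊗[𝕜] A →ₗ[𝕜] A ⊗[𝕜] B) : Set P :=
  {x | ∃ a b, x = ιB b * ιA a - mulMapP 𝕜 A B P ιA ιB (τ (b ⊗ₜ[𝕜] a))}

/-- The (Künneth) grading on the free product `P` of the graded algebras `A` and `B`. -/
def freeProdGrade (P : Type) [Ring P] [Algebra 𝕜 P] (ιA : A →ₐ[𝕜] P) (ιB : B →ₐ[𝕜] P)
    (𝒜 : ℕ → Submodule 𝕜 A) (ℬ : ℕ → Submodule 𝕜 B) (n : ℕ) : Submodule 𝕜 P :=
  ⨆ (l : List ℕ) (_ : l.sum = n),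
    ((l.map (fun i => Submodule.map ιA.toLinearMap (𝒜 i) ⊔ Submodule.map ιB.toLinearMap (ℬ i))).foldr
      (· * ·) 1)

end TTP

namespace TTP

open TensorProduct DirectSum

section GradedFinsupp

theorem mem_freeGrade {𝕜 : Type} [Field 𝕜] {R : Type} [Ring R] [Algebra 𝕜 R]
    (ℛ : ℕ → Submodule 𝕜 R) {i n : ℕ} {σ : Type} {x : σ →₀ R} :
    x ∈ freeGrade 𝕜 R ℛ i σ n ↔ ∀ s, x s ∈ if i ≤ n then ℛ (n - i) else ⊥ := by
  simp [freeGrade]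

variable {𝕜 : Type} [Field 𝕜] {R : Type} [Ring R] [Algebra 𝕜 R]
  (ℛ : ℕ → Submodule 𝕜 R) [GradedAlgebra ℛ]

theorem proj_mem (n : ℕ) (x : R) : GradedAlgebra.proj ℛ n x ∈ ℛ n :=
  SetLike.coe_mem (decompose ℛ x n)

theorem proj_of_mem {n : ℕ} {x : R} (hx : x ∈ ℛ n) : GradedAlgebra.proj ℛ n x = x :=
  decompose_of_mem_same ℛ hx

theorem proj_of_mem_ne {m n : ℕ} {x : R} (hx : x ∈ ℛ m) (h : m ≠ n) :
    GradedAlgebra.proj ℛ n x = 0 :=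
  decompose_of_mem_ne ℛ hx h

theorem proj_mul_right {m n : ℕ} (x : R) {y : R} (hy : y ∈ ℛ m) :
    GradedAlgebra.proj ℛ (n + m) (x * y) = GradedAlgebra.proj ℛ n x * y :=
  coe_decompose_mul_add_of_right_mem ℛ hy

/-- The coefficientwise projection of `σ →₀ R` onto its coefficients of degree `n`. -/
def fproj (σ : Type) (n : ℕ) : (σ →₀ R) →ₗ[𝕜] (σ →₀ R) :=
  Finsupp.mapRange.linearMap (GradedAlgebra.proj ℛ n)

@[simp] theorem fproj_apply {σ : Type} (n : ℕ) (x : σ →₀ R) (s : σ) :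
    fproj ℛ σ n x s = GradedAlgebra.proj ℛ n (x s) := by
  simp [fproj]

theorem fproj_mem {σ : Type} (n : ℕ) (x : σ →₀ R) (s : σ) : fproj ℛ σ n x s ∈ ℛ n := by
  rw [fproj_apply]; exact proj_mem ℛ n _

theorem fproj_of_mem {σ : Type} {n : ℕ} {x : σ →₀ R} (hx : ∀ s, x s ∈ ℛ n) :
    fproj ℛ σ n x = x := by
  ext s; rw [fproj_apply, proj_of_mem ℛ (hx s)]

theorem linearMap_apply_coeff {σ σ' : Type} (L : (σ →₀ R) →ₗ[R] (σ' →₀ R)) (x : σ →₀ R) (t : σ') :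
    L x t = x.sum fun s c => c * L (Finsupp.single s 1) t := by
  have h : L x = x.sum fun s c => c • L (Finsupp.single s 1) := by
    conv_lhs => rw [← Finsupp.sum_single x]
    rw [map_finsuppSum]
    refine Finsupp.sum_congr fun s _ => ?_
    rw [← map_smul, Finsupp.smul_single, smul_eq_mul, mul_one]
  rw [h, Finsupp.sum, Finsupp.finsetSum_apply]
  rfl

/-- A linear map between free modules sending generators to degree one coefficients shifts the
coefficient degree by one. -/
theorem map_fproj {σ σ' : Type} (L : (σ →₀ R) →ₗ[R] (σ' →₀ R))
    (hL : ∀ s t, L (Finsupp.single s 1) t ∈ ℛ 1) (n : ℕ) (x : σ →₀ R) :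
    L (fproj ℛ σ n x) = fproj ℛ σ' (n + 1) (L x) := by
  induction x using Finsupp.induction_linear with
  | zero => simp
  | add x y hx hy => simp only [map_add, hx, hy]
  | single s c =>
    have h1 : fproj ℛ σ n (Finsupp.single s c) = Finsupp.single s (GradedAlgebra.proj ℛ n c) := by
      simp [fproj]
    rw [h1]
    ext t
    have key : ∀ c : R, L (Finsupp.single s c) t = c * L (Finsupp.single s 1) t := fun c => by
      rw [← smul_eq_mul, ← Finsupp.smul_apply, ← map_smul, Finsupp.smul_single, smul_eq_mul,
        mul_one]
    rw [fproj_apply, key _, key c, proj_mul_right ℛ _ (hL s t)]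

theorem map_mem_freeGrade {σ σ' : Type} (L : (σ →₀ R) →ₗ[R] (σ' →₀ R))
    (hL : ∀ s t, L (Finsupp.single s 1) t ∈ ℛ 1) (i n : ℕ) (x : σ →₀ R)
    (hx : x ∈ freeGrade 𝕜 R ℛ (i + 1) σ n) : L x ∈ freeGrade 𝕜 R ℛ i σ' n := by
  rw [mem_freeGrade] at hx ⊢
  intro t
  rw [linearMap_apply_coeff]
  by_cases h : i + 1 ≤ n
  · simp only [h, if_true] at hx
    rw [if_pos (by omega)]
    refine Submodule.sum_mem _ fun s _ => ?_
    have := SetLike.mul_mem_graded (hx s) (hL s t)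
    rwa [show n - (i + 1) + 1 = n - i by omega] at this
  · simp only [h, if_false, Submodule.mem_bot] at hx
    refine Submodule.sum_mem _ fun s _ => ?_
    simp only [hx s, zero_mul]
    exact Submodule.zero_mem _

theorem map_single_mem_of_freeGrade {σ σ' : Type} (L : (σ →₀ R) →ₗ[R] (σ' →₀ R)) (i : ℕ)
    (hL : ∀ n, ∀ x ∈ freeGrade 𝕜 R ℛ (i + 1) σ n, L x ∈ freeGrade 𝕜 R ℛ i σ' n) (s : σ) (t : σ') :
    L (Finsupp.single s 1) t ∈ ℛ 1 := by
  classical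
  have h := hL (i + 1) (Finsupp.single s 1) (by
    rw [mem_freeGrade]
    intro u
    rw [if_pos le_rfl, Nat.sub_self, Finsupp.single_apply]
    split_ifs
    · exact SetLike.one_mem_graded ℛ
    · exact Submodule.zero_mem _)
  have := (mem_freeGrade ℛ).1 h t
  rwa [if_pos (by omega), show i + 1 - i = 1 by omega] at this

theorem mem_augIdeal {x : R} : x ∈ augIdeal 𝕜 R ℛ ↔ GradedAlgebra.proj ℛ 0 x = 0 := by
  classical
  constructor
  · intro hx
    induction hx using Submodule.span_induction with
    | mem x hx =>
      obtain ⟨i, hi, hx⟩ := hx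
      exact proj_of_mem_ne ℛ hx hi.ne'
    | zero => exact map_zero _
    | add x y _ _ hx hy => rw [map_add, hx, hy, add_zero]
    | smul c x _ hx =>
      have := map_mul (GradedRing.projZeroRingHom ℛ) c x
      simp only [GradedRing.projZeroRingHom_apply] at this
      rw [GradedAlgebra.proj_apply] at hx ⊢
      rw [smul_eq_mul, this, hx, mul_zero]
  · intro hx
    rw [← sum_support_decompose ℛ x]
    refine Submodule.sum_mem _ fun i _ => ?_
    rcases Nat.eq_zero_or_pos i with rfl | hi
    · rw [show (decompose ℛ x 0 : R) = 0 from hx]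
      exact Submodule.zero_mem _
    · exact Submodule.subset_span ⟨i, hi, SetLike.coe_mem _⟩

theorem mul_mem_augIdeal_right {x : R} (hx : x ∈ augIdeal 𝕜 R ℛ) (y : R) :
    x * y ∈ augIdeal 𝕜 R ℛ := by
  rw [mem_augIdeal] at hx ⊢
  have := map_mul (GradedRing.projZeroRingHom ℛ) x y
  simp only [GradedRing.projZeroRingHom_apply] at this
  rw [GradedAlgebra.proj_apply] at hx ⊢
  rw [this, hx, zero_mul]

end GradedFinsupp

/-- The data extracted from a separable twisted tensor product of `A` with a free algebra: an
extension `C` of `A` in which every element is uniquely `a + ∑ cₖ wₖ`, the `wₖ` being degree one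
elements split into two families, `w (inl k)` and `w (inr k)`, each of which moves past `A` in a
controlled way. -/
structure SepExt {𝕜 : Type} [Field 𝕜] {A : Type} [Ring A] [Algebra 𝕜 A]
    (𝒜 : ℕ → Submodule 𝕜 A) {C : Type} [Ring C] [Algebra 𝕜 C] (𝒞 : ℕ → Submodule 𝕜 C)
    (κ₁ κ₂ : Type) [Fintype κ₁] [Fintype κ₂] [DecidableEq κ₁] [DecidableEq κ₂] where
  /-- the inclusion of `A` -/
  α : A →ₐ[𝕜] C
  /-- the free generators -/
  w : κ₁ ⊕ κ₂ → C
  /-- the `A`-coordinate -/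
  π : C →ₗ[𝕜] A
  /-- the coordinates along the generators -/
  co : κ₁ ⊕ κ₂ → C →ₗ[𝕜] C
  α_mem : ∀ n, ∀ a ∈ 𝒜 n, α a ∈ 𝒞 n
  w_mem : ∀ k, w k ∈ 𝒞 1
  expand : ∀ c, c = α (π c) + ∑ k, co k c * w k
  π_α : ∀ a, π (α a) = a
  co_α : ∀ k a, co k (α a) = 0
  π_mul : ∀ c k, π (c * w k) = 0
  co_mul : ∀ k c l, co k (c * w l) = if k = l then c else 0
  inl_mul : ∀ k a, ∃ (a₀ : A) (f : κ₁ → A),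
    w (.inl k) * α a = α a₀ + ∑ l, α (f l) * w (.inl l)
  inr_mul : ∀ k a, ∃ f : κ₂ → C, w (.inr k) * α a = ∑ l, f l * w (.inr l)
  ind : ∀ P : C → Prop, (∀ x y, P x → P y → P (x + y)) → (∀ a, P (α a)) →
    (∀ c k, P c → P (c * w k)) → ∀ c, P c

namespace SepExt

variable {𝕜 : Type} [Field 𝕜] {A : Type} [Ring A] [Algebra 𝕜 A]
  {𝒜 : ℕ → Submodule 𝕜 A} {C : Type} [Ring C] [Algebra 𝕜 C] {𝒞 : ℕ → Submodule 𝕜 C}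
  {κ₁ κ₂ : Type} [Fintype κ₁] [Fintype κ₂] [DecidableEq κ₁] [DecidableEq κ₂]
  (D : SepExt 𝒜 𝒞 κ₁ κ₂)

theorem α_injective : Function.Injective D.α := fun a b h => by
  rw [← D.π_α a, h, D.π_α]

/-- The filtration of `C` by the length of the trailing string of generators of the first family. -/
def filt : ℕ → Submodule 𝕜 C
  | 0 => ⨅ k : κ₁, (⊥ : Submodule 𝕜 C).comap (D.co (.inl k))
  | n + 1 => ⨅ k : κ₁, (filt n).comap (D.co (.inl k))

theorem mem_filt_zero {c : C} : c ∈ D.filt 0 ↔ ∀ k, D.co (.inl k) c = 0 := by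
  simp [filt]

theorem mem_filt_succ {n : ℕ} {c : C} : c ∈ D.filt (n + 1) ↔ ∀ k, D.co (.inl k) c ∈ D.filt n := by
  simp [filt]

theorem filt_mono : Monotone D.filt := by
  refine monotone_nat_of_le_succ fun n => ?_
  induction n with
  | zero =>
    intro c hc
    rw [mem_filt_zero] at hc
    rw [mem_filt_succ]
    intro k
    rw [hc k]
    exact Submodule.zero_mem _
  | succ n ih =>
    intro c hc
    rw [mem_filt_succ] at hc ⊢
    exact fun k => ih (hc k)

theorem α_mem_filt (n : ℕ) (a : A) : D.α a ∈ D.filt n :=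
  D.filt_mono (Nat.zero_le n) <| D.mem_filt_zero.2 fun _ => D.co_α _ a

theorem mul_inr_mem_filt (n : ℕ) (c : C) (k : κ₂) : c * D.w (.inr k) ∈ D.filt n :=
  D.filt_mono (Nat.zero_le n) <| D.mem_filt_zero.2 fun _ => by rw [D.co_mul, if_neg (by simp)]

theorem mul_inl_mem_filt {n : ℕ} {c : C} (hc : c ∈ D.filt n) (k : κ₁) :
    c * D.w (.inl k) ∈ D.filt (n + 1) := by
  rw [mem_filt_succ]
  intro l
  rw [D.co_mul]
  split_ifs
  · exact hc
  · exact Submodule.zero_mem _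

theorem mul_inr_mul_mem_filt (n : ℕ) (c : C) (k : κ₂) (a : A) :
    c * D.w (.inr k) * D.α a ∈ D.filt n := by
  obtain ⟨f, hf⟩ := D.inr_mul k a
  rw [mul_assoc, hf, Finset.mul_sum]
  refine Submodule.sum_mem _ fun l _ => ?_
  rw [← mul_assoc]
  exact D.mul_inr_mem_filt n _ l

theorem mul_α_mem_filt {n : ℕ} {c : C} (hc : c ∈ D.filt n) (a : A) : c * D.α a ∈ D.filt n := by
  induction n generalizing c a with
  | zero =>
    rw [mem_filt_zero] at hc
    rw [D.expand c, Fintype.sum_sum_type, add_mul, add_mul, Finset.sum_mul, Finset.sum_mul,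
      ← map_mul]
    refine add_mem (D.α_mem_filt _ _) (add_mem ?_ ?_)
    · refine Submodule.sum_mem _ fun k _ => ?_
      rw [hc k, zero_mul, zero_mul]
      exact Submodule.zero_mem _
    · exact Submodule.sum_mem _ fun k _ => D.mul_inr_mul_mem_filt _ _ k a
  | succ n ih =>
    rw [mem_filt_succ] at hc
    rw [D.expand c, Fintype.sum_sum_type, add_mul, add_mul, Finset.sum_mul, Finset.sum_mul,
      ← map_mul]
    refine add_mem (D.α_mem_filt _ _) (add_mem ?_ ?_)
    · refine Submodule.sum_mem _ fun k _ => ?_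
      obtain ⟨a₀, f, hf⟩ := D.inl_mul k a
      rw [mul_assoc, hf, mul_add, Finset.mul_sum]
      refine add_mem (D.filt_mono n.le_succ (ih (hc k) a₀)) (Submodule.sum_mem _ fun l _ => ?_)
      rw [← mul_assoc]
      exact D.mul_inl_mem_filt (ih (hc k) _) l
    · exact Submodule.sum_mem _ fun k _ => D.mul_inr_mul_mem_filt _ _ k a

theorem exists_mem_filt (c : C) : ∃ n, c ∈ D.filt n := by
  refine D.ind (fun c => ∃ n, c ∈ D.filt n) ?_ (fun a => ⟨0, D.α_mem_filt 0 a⟩) ?_ c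
  · rintro x y ⟨m, hm⟩ ⟨n, hn⟩
    exact ⟨max m n, add_mem (D.filt_mono (le_max_left _ _) hm) (D.filt_mono (le_max_right _ _) hn)⟩
  · rintro c (k | k) ⟨n, hn⟩
    · exact ⟨n + 1, D.mul_inl_mem_filt hn k⟩
    · exact ⟨0, D.mul_inr_mem_filt 0 c k⟩

/-- The inclusion of free modules induced by `A → C`. -/
def incl (σ : Type) : (σ →₀ A) →ₗ[𝕜] (σ →₀ C) :=
  Finsupp.mapRange.linearMap D.α.toLinearMap

@[simp] theorem incl_apply {σ : Type} (m : σ →₀ A) (s : σ) : D.incl σ m s = D.α (m s) := by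
  simp [incl]

@[simp] theorem incl_single {σ : Type} (s : σ) (a : A) :
    D.incl σ (Finsupp.single s a) = Finsupp.single s (D.α a) := by
  simp [incl]

theorem incl_smul {σ : Type} (a : A) (m : σ →₀ A) : D.incl σ (a • m) = D.α a • D.incl σ m := by
  ext s; simp

/-- The relations `w s - β_w(s)` of the `C`-module structure on `σ →₀ A` determined by `β`, where
the second family of generators annihilates the basis. -/
def rel {σ : Type} (β : κ₁ → σ → (σ →₀ A)) : ((κ₁ ⊕ κ₂) × σ →₀ C) →ₗ[C] (σ →₀ C) :=
  Finsupp.linearCombination C fun p =>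
    Finsupp.single p.2 (D.w p.1) - D.incl σ ((Sum.elim β 0 : κ₁ ⊕ κ₂ → σ → (σ →₀ A)) p.1 p.2)

theorem rel_single {σ : Type} (β : κ₁ → σ → (σ →₀ A)) (k : κ₁ ⊕ κ₂) (s : σ) (c : C) :
    D.rel β (Finsupp.single (k, s) c) = Finsupp.single s (c * D.w k) -
      c • D.incl σ ((Sum.elim β 0 : κ₁ ⊕ κ₂ → σ → (σ →₀ A)) k s) := by
  simp [rel, smul_sub]

theorem rel_single_inr {σ : Type} (β : κ₁ → σ → (σ →₀ A)) (k : κ₂) (s : σ) (c : C) :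
    D.rel β (Finsupp.single (.inr k, s) c) = Finsupp.single s (c * D.w (.inr k)) := by
  simp [rel_single]

theorem rel_single_inl {σ : Type} (β : κ₁ → σ → (σ →₀ A)) (k : κ₁) (s : σ) (c : C) :
    D.rel β (Finsupp.single (.inl k, s) c) = Finsupp.single s (c * D.w (.inl k)) -
      c • D.incl σ (β k s) := by
  simp [rel_single]

theorem rel_single_mem [GradedAlgebra 𝒞] {σ : Type} (β : κ₁ → σ → (σ →₀ A))
    (hβ : ∀ k s t, β k s t ∈ 𝒜 1) (p : (κ₁ ⊕ κ₂) × σ) (t : σ) :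
    D.rel β (Finsupp.single p 1) t ∈ 𝒞 1 := by
  classical
  have h1 : ∀ k s, (Finsupp.single s (1 * D.w k) : σ →₀ C) t ∈ 𝒞 1 := fun k s => by
    rw [one_mul, Finsupp.single_apply]
    split_ifs
    · exact D.w_mem k
    · exact Submodule.zero_mem _
  obtain ⟨k | k, s⟩ := p
  · rw [rel_single_inl, one_smul, Finsupp.sub_apply, incl_apply]
    exact sub_mem (h1 _ _) (D.α_mem _ _ (hβ k s t))
  · rw [rel_single_inr]
    exact h1 _ _

/-- Every element of a free module is a combination of relations, up to an element with
coefficients in `A`. -/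
theorem exists_eq_incl_add_rel {σ : Type} (β : κ₁ → σ → (σ →₀ A)) (x : σ →₀ C) :
    ∃ m q, x = D.incl σ m + D.rel β q := by
  let N : AddSubgroup (σ →₀ C) :=
    (D.incl σ).toAddMonoidHom.range ⊔ (D.rel β).toAddMonoidHom.range
  have hincl : ∀ m, D.incl σ m ∈ N := fun m =>
    AddSubgroup.mem_sup_left (AddMonoidHom.mem_range.2 ⟨m, rfl⟩)
  have hrel : ∀ q, D.rel β q ∈ N := fun q =>
    AddSubgroup.mem_sup_right (AddMonoidHom.mem_range.2 ⟨q, rfl⟩)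
  have hw : ∀ k m, D.w k • D.incl σ m ∈ N := by
    intro k m
    induction m using Finsupp.induction_linear with
    | zero => simp [N.zero_mem]
    | add x y hx hy => rw [map_add, smul_add]; exact N.add_mem hx hy
    | single s a =>
      rw [incl_single, Finsupp.smul_single, smul_eq_mul]
      rcases k with k | k
      · obtain ⟨a₀, f, hf⟩ := D.inl_mul k a
        rw [hf, Finsupp.single_add, ← D.incl_single, Finsupp.single_finsetSum]
        refine N.add_mem (hincl _) (AddSubgroup.sum_mem _ fun l _ => ?_)
        have := D.rel_single_inl β l s (D.α (f l))
        rw [sub_eq_iff_eq_add.1 this.symm, ← incl_smul]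
        exact N.add_mem (hrel _) (hincl _)
      · obtain ⟨f, hf⟩ := D.inr_mul k a
        rw [hf, Finsupp.single_finsetSum]
        refine AddSubgroup.sum_mem _ fun l _ => ?_
        rw [← D.rel_single_inr β]
        exact hrel _
  have hsmul : ∀ c : C, ∀ y ∈ N, c • y ∈ N := by
    refine D.ind _ ?_ ?_ ?_
    · intro x y hx hy z hz
      rw [add_smul]
      exact N.add_mem (hx z hz) (hy z hz)
    · intro a y hy
      obtain ⟨_, ⟨m, rfl⟩, _, ⟨q, rfl⟩, rfl⟩ := AddSubgroup.mem_sup.1 hy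
      rw [smul_add]
      refine N.add_mem ?_ ?_
      · exact D.incl_smul a m ▸ hincl (a • m)
      · exact (D.rel β).map_smul (D.α a) q ▸ hrel _
    · intro c k hc y hy
      rw [mul_smul]
      refine hc _ ?_
      obtain ⟨_, ⟨m, rfl⟩, _, ⟨q, rfl⟩, rfl⟩ := AddSubgroup.mem_sup.1 hy
      rw [smul_add]
      refine N.add_mem (hw k m) ?_
      exact (D.rel β).map_smul (D.w k) q ▸ hrel _
  have hx : x ∈ N := by
    induction x using Finsupp.induction_linear with
    | zero => exact N.zero_mem
    | add x y hx hy => exact N.add_mem hx hy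
    | single s c =>
      have := hsmul c (D.incl σ (Finsupp.single s 1)) (hincl _)
      rwa [incl_single, map_one, Finsupp.smul_single, smul_eq_mul, mul_one] at this
  obtain ⟨_, ⟨m, rfl⟩, _, ⟨q, rfl⟩, rfl⟩ := AddSubgroup.mem_sup.1 hx
  exact ⟨m, q, rfl⟩

theorem coeff_eq_of_rel_eq {σ : Type} (β : κ₁ → σ → (σ →₀ A)) (q : (κ₁ ⊕ κ₂) × σ →₀ C)
    (k : κ₁ ⊕ κ₂) (t : σ) :
    q (k, t) = D.co k (D.rel β q t) + D.co k (q.sum fun p c =>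
      c * D.α ((Sum.elim β 0 : κ₁ ⊕ κ₂ → σ → (σ →₀ A)) p.1 p.2 t)) := by
  classical
  induction q using Finsupp.induction_linear with
  | zero => simp
  | add x y hx hy =>
    rw [Finsupp.sum_add_index' (by simp) (by intros; rw [add_mul]), map_add, Finsupp.add_apply,
      Finsupp.add_apply, map_add, map_add, hx, hy]
    abel
  | single p c =>
    obtain ⟨l, s⟩ := p
    rw [Finsupp.sum_single_index (by simp), rel_single, Finsupp.sub_apply, Finsupp.smul_apply,
      incl_apply, smul_eq_mul, ← map_add, sub_add_cancel, Finsupp.single_apply,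
      Finsupp.single_apply]
    by_cases h : s = t
    · simp [h, D.co_mul, eq_comm]
    · simp [h]

/-- The relations are free, and independent of the elements with coefficients in `A`. -/
theorem eq_zero_of_rel_eq_incl {σ : Type} (β : κ₁ → σ → (σ →₀ A)) {q : (κ₁ ⊕ κ₂) × σ →₀ C}
    {m : σ →₀ A} (h : D.rel β q = D.incl σ m) : q = 0 ∧ m = 0 := by
  classical
  have hco : ∀ k t, q (k, t) = D.co k (q.sum fun p c =>
      c * D.α ((Sum.elim β 0 : κ₁ ⊕ κ₂ → σ → (σ →₀ A)) p.1 p.2 t)) := fun k t => by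
    rw [D.coeff_eq_of_rel_eq β q k t, h, incl_apply, D.co_α, zero_add]
  have hmem : ∀ n, (∀ k s, q (.inl k, s) ∈ D.filt n) → ∀ t, (q.sum fun p c =>
      c * D.α ((Sum.elim β 0 : κ₁ ⊕ κ₂ → σ → (σ →₀ A)) p.1 p.2 t)) ∈ D.filt n := by
    intro n hn t
    refine Submodule.sum_mem _ fun p _ => ?_
    obtain ⟨k | k, s⟩ := p
    · exact D.mul_α_mem_filt (hn k s) _
    · simp
  have hzero : ∀ n, (∀ k s, q (.inl k, s) ∈ D.filt n) → ∀ k s, q (.inl k, s) = 0 := by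
    intro n
    induction n with
    | zero =>
      intro hn k s
      rw [hco]
      exact D.mem_filt_zero.1 (hmem 0 hn s) k
    | succ n ih =>
      intro hn
      refine ih fun k s => ?_
      rw [hco]
      exact D.mem_filt_succ.1 (hmem (n + 1) hn s) k
  have hinl : ∀ k s, q (.inl k, s) = 0 := by
    choose ν hν using D.exists_mem_filt
    refine hzero (q.support.sup fun p => ν (q p)) fun k s => ?_
    by_cases hq : q (.inl k, s) = 0
    · rw [hq]
      exact Submodule.zero_mem _
    · exact D.filt_mono (Finset.le_sup (f := fun p => ν (q p)) (Finsupp.mem_support_iff.2 hq))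
        (hν _)
  have hq : q = 0 := by
    ext ⟨k, s⟩
    rw [hco, Finsupp.sum, Finset.sum_eq_zero, map_zero, Finsupp.zero_apply]
    rintro ⟨k | k, s⟩ -
    · rw [hinl, zero_mul]
    · simp
  refine ⟨hq, ?_⟩
  ext s
  rw [hq, map_zero] at h
  apply D.α_injective
  rw [← incl_apply, ← h]
  simp

theorem rel_injective {σ : Type} (β : κ₁ → σ → (σ →₀ A)) : Function.Injective (D.rel β) := by
  rw [injective_iff_map_eq_zero]
  intro q hq
  exact (D.eq_zero_of_rel_eq_incl β (m := 0) (by rw [hq, map_zero])).1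

end SepExt

section Cone

variable {C : Type} [Ring C] {X₀ X₁ X₂ Y₀ Y₁ : Type}

/-- The map `(p, q) ↦ f p + r q` out of a free module on a disjoint union. -/
def coneEnd (f : (X₁ →₀ C) →ₗ[C] (X₀ →₀ C)) (r : (Y₀ →₀ C) →ₗ[C] (X₀ →₀ C)) :
    (X₁ ⊕ Y₀ →₀ C) →ₗ[C] (X₀ →₀ C) :=
  f.coprod r ∘ₗ (Finsupp.sumFinsuppLEquivProdFinsupp C).toLinearMap

/-- The mapping cone differential `(p, q) ↦ (f p + r q, -g q)`. -/
def coneD (f : (X₂ →₀ C) →ₗ[C] (X₁ →₀ C)) (r : (Y₁ →₀ C) →ₗ[C] (X₁ →₀ C))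
    (g : (Y₁ →₀ C) →ₗ[C] (Y₀ →₀ C)) : (X₂ ⊕ Y₁ →₀ C) →ₗ[C] (X₁ ⊕ Y₀ →₀ C) :=
  (Finsupp.sumFinsuppLEquivProdFinsupp C).symm.toLinearMap ∘ₗ
    (f.coprod r).prod (-(g ∘ₗ LinearMap.snd C _ _)) ∘ₗ
    (Finsupp.sumFinsuppLEquivProdFinsupp C).toLinearMap

theorem coneEnd_symm (f : (X₁ →₀ C) →ₗ[C] (X₀ →₀ C)) (r : (Y₀ →₀ C) →ₗ[C] (X₀ →₀ C))
    (p : X₁ →₀ C) (q : Y₀ →₀ C) :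
    coneEnd f r ((Finsupp.sumFinsuppLEquivProdFinsupp C).symm (p, q)) = f p + r q := by
  simp [coneEnd]

theorem coneD_symm (f : (X₂ →₀ C) →ₗ[C] (X₁ →₀ C)) (r : (Y₁ →₀ C) →ₗ[C] (X₁ →₀ C))
    (g : (Y₁ →₀ C) →ₗ[C] (Y₀ →₀ C)) (p : X₂ →₀ C) (q : Y₁ →₀ C) :
    coneD f r g ((Finsupp.sumFinsuppLEquivProdFinsupp C).symm (p, q)) =
      (Finsupp.sumFinsuppLEquivProdFinsupp C).symm (f p + r q, -g q) := by
  simp [coneD]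

theorem ker_coneD {f₀ : (X₁ →₀ C) →ₗ[C] (X₀ →₀ C)} {f₁ : (X₂ →₀ C) →ₗ[C] (X₁ →₀ C)}
    {r₀ : (Y₀ →₀ C) →ₗ[C] (X₀ →₀ C)} {r₁ : (Y₁ →₀ C) →ₗ[C] (X₁ →₀ C)}
    {g : (Y₁ →₀ C) →ₗ[C] (Y₀ →₀ C)} (hr : Function.Injective r₀)
    (hg : ∀ q, r₀ (g q) = f₀ (r₁ q)) (hf : ∀ p, f₀ (f₁ p) = 0) :
    LinearMap.ker (coneD f₁ r₁ g) = LinearMap.ker (coneEnd f₁ r₁) := by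
  ext x
  obtain ⟨⟨p, q⟩, rfl⟩ := (Finsupp.sumFinsuppLEquivProdFinsupp C).symm.surjective x
  rw [LinearMap.mem_ker, LinearMap.mem_ker, coneD_symm, coneEnd_symm, LinearEquiv.map_eq_zero_iff,
    Prod.mk_eq_zero, neg_eq_zero]
  refine ⟨fun h => h.1, fun h => ⟨h, hr ?_⟩⟩
  have := congrArg f₀ h
  rwa [map_add, hf, zero_add, map_zero, ← hg, ← map_zero r₀] at this

theorem range_coneD {f₀ : (X₁ →₀ C) →ₗ[C] (X₀ →₀ C)} {f₁ : (X₂ →₀ C) →ₗ[C] (X₁ →₀ C)}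
    {r₀ : (Y₀ →₀ C) →ₗ[C] (X₀ →₀ C)} {r₁ : (Y₁ →₀ C) →ₗ[C] (X₁ →₀ C)}
    {g : (Y₁ →₀ C) →ₗ[C] (Y₀ →₀ C)} (hr : Function.Injective r₀)
    (hg : ∀ q, r₀ (g q) = f₀ (r₁ q)) (hf : ∀ p, f₀ (f₁ p) = 0)
    (hex : ∀ p q, f₀ p = r₀ q → ∃ m q', p = f₁ m + r₁ q') :
    LinearMap.range (coneD f₁ r₁ g) = LinearMap.ker (coneEnd f₀ r₀) := by
  ext x
  rw [LinearMap.mem_ker, LinearMap.mem_range]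
  constructor
  · rintro ⟨y, rfl⟩
    obtain ⟨⟨p, q⟩, rfl⟩ := (Finsupp.sumFinsuppLEquivProdFinsupp C).symm.surjective y
    rw [coneD_symm, coneEnd_symm, map_add, hf, map_neg, hg, zero_add, add_neg_cancel]
  · intro h
    obtain ⟨⟨p, q⟩, rfl⟩ := (Finsupp.sumFinsuppLEquivProdFinsupp C).symm.surjective x
    rw [coneEnd_symm] at h
    obtain ⟨m, q', rfl⟩ := hex p (-q) (by rw [map_neg]; exact eq_neg_of_add_eq_zero_left h)
    refine ⟨(Finsupp.sumFinsuppLEquivProdFinsupp C).symm (m, q'), ?_⟩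
    rw [coneD_symm]
    congr 1
    refine Prod.ext rfl (hr ?_)
    rw [map_add, hf, zero_add] at h
    rw [map_neg, hg]
    exact neg_eq_of_add_eq_zero_right h

theorem single_inl_eq (a : X₁) : (Finsupp.single (Sum.inl a : X₁ ⊕ Y₀) (1 : C)) =
    (Finsupp.sumFinsuppLEquivProdFinsupp C).symm (Finsupp.single a 1, 0) := by
  classical
  ext (x | x) <;> simp [Finsupp.single_apply]

theorem single_inr_eq (b : Y₀) : (Finsupp.single (Sum.inr b : X₁ ⊕ Y₀) (1 : C)) =
    (Finsupp.sumFinsuppLEquivProdFinsupp C).symm (0, Finsupp.single b 1) := by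
  classical
  ext (x | x) <;> simp [Finsupp.single_apply]

theorem coneEnd_single_mem {f : (X₁ →₀ C) →ₗ[C] (X₀ →₀ C)} {r : (Y₀ →₀ C) →ₗ[C] (X₀ →₀ C)}
    {s : Set C} (hf : ∀ p t, f (Finsupp.single p 1) t ∈ s)
    (hr : ∀ p t, r (Finsupp.single p 1) t ∈ s) (p : X₁ ⊕ Y₀) (t : X₀) :
    coneEnd f r (Finsupp.single p 1) t ∈ s := by
  rcases p with p | p
  · rw [single_inl_eq, coneEnd_symm, map_zero, add_zero]
    exact hf p t
  · rw [single_inr_eq, coneEnd_symm, map_zero, zero_add]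
    exact hr p t

theorem coneD_single_mem {f : (X₂ →₀ C) →ₗ[C] (X₁ →₀ C)} {r : (Y₁ →₀ C) →ₗ[C] (X₁ →₀ C)}
    {g : (Y₁ →₀ C) →ₗ[C] (Y₀ →₀ C)} {s : AddSubgroup C}
    (hf : ∀ p t, f (Finsupp.single p 1) t ∈ s) (hr : ∀ p t, r (Finsupp.single p 1) t ∈ s)
    (hg : ∀ p t, g (Finsupp.single p 1) t ∈ s) (p : X₂ ⊕ Y₁) (t : X₁ ⊕ Y₀) :
    coneD f r g (Finsupp.single p 1) t ∈ s := by
  rcases p with p | p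
  · rw [single_inl_eq, coneD_symm, map_zero, add_zero, map_zero, neg_zero]
    rcases t with t | t
    · simpa using hf p t
    · simp
  · rw [single_inr_eq, coneD_symm, map_zero, zero_add]
    rcases t with t | t
    · simpa using hr p t
    · simpa using hg p t

variable {ι : Type} {σ : ℕ → Type}

/-- The index types of the total complex of a map of two-term complexes of free modules. -/
def totIndex (ι : Type) (σ : ℕ → Type) : ℕ → Type
  | 0 => σ 0
  | i + 1 => σ (i + 1) ⊕ (ι × σ i)

/-- The differential of the total complex. -/
def totD (F : ∀ i, (σ (i + 1) →₀ C) →ₗ[C] (σ i →₀ C)) (r : ∀ i, (ι × σ i →₀ C) →ₗ[C] (σ i →₀ C))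
    (g : ∀ i, (ι × σ (i + 1) →₀ C) →ₗ[C] (ι × σ i →₀ C)) :
    ∀ i, (totIndex ι σ (i + 1) →₀ C) →ₗ[C] (totIndex ι σ i →₀ C)
  | 0 => coneEnd (F 0) (r 0)
  | i + 1 => coneD (F (i + 1)) (r (i + 1)) (g i)

variable {F : ∀ i, (σ (i + 1) →₀ C) →ₗ[C] (σ i →₀ C)}
  {r : ∀ i, (ι × σ i →₀ C) →ₗ[C] (σ i →₀ C)}
  {g : ∀ i, (ι × σ (i + 1) →₀ C) →ₗ[C] (ι × σ i →₀ C)}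

theorem totD_exact (hr : ∀ i, Function.Injective (r i))
    (hg : ∀ i q, r i (g i q) = F i (r (i + 1) q)) (hF : ∀ i p, F i (F (i + 1) p) = 0)
    (hex : ∀ i p q, F i p = r i q → ∃ m q', p = F (i + 1) m + r (i + 1) q') (i : ℕ) :
    LinearMap.ker (totD F r g i) = LinearMap.range (totD F r g (i + 1)) := by
  cases i with
  | zero => exact (range_coneD (hr 0) (hg 0) (hF 0) (hex 0)).symm
  | succ i =>
    exact (ker_coneD (hr i) (hg i) (hF i)).trans
      (range_coneD (hr (i + 1)) (hg (i + 1)) (hF (i + 1)) (hex (i + 1))).symm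

theorem totD_single_mem {s : AddSubgroup C}
    (hF : ∀ i p t, F i (Finsupp.single p 1) t ∈ s) (hr : ∀ i p t, r i (Finsupp.single p 1) t ∈ s)
    (hg : ∀ i p t, g i (Finsupp.single p 1) t ∈ s) (i : ℕ) (p : totIndex ι σ (i + 1))
    (t : totIndex ι σ i) : totD F r g i (Finsupp.single p 1) t ∈ s := by
  cases i with
  | zero => exact coneEnd_single_mem (f := F 0) (r := r 0) (s := (s : Set C)) (hF 0) (hr 0) p t
  | succ i => exact coneD_single_mem (hF (i + 1)) (hr (i + 1)) (hg i) p t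

end Cone

theorem linearMap_coeff_mem_augIdeal {𝕜 : Type} [Field 𝕜] {R : Type} [Ring R] [Algebra 𝕜 R]
    (ℛ : ℕ → Submodule 𝕜 R) {σ σ' : Type} (L : (σ →₀ R) →ₗ[R] (σ' →₀ R))
    (hL : ∀ s t, L (Finsupp.single s 1) t ∈ ℛ 1) (x : σ →₀ R) (t : σ') :
    L x t ∈ augIdeal 𝕜 R ℛ := by
  rw [linearMap_apply_coeff]
  exact Submodule.sum_mem _ fun s _ =>
    (augIdeal 𝕜 R ℛ).smul_mem _ (Submodule.subset_span ⟨1, one_pos, hL s t⟩)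

theorem linearCombination_mem_augIdeal {𝕜 : Type} [Field 𝕜] {R : Type} [Ring R] [Algebra 𝕜 R]
    (ℛ : ℕ → Submodule 𝕜 R) [GradedAlgebra ℛ] {σ : Type} (e : σ → R) {x : σ →₀ R}
    (hx : ∀ s, x s ∈ augIdeal 𝕜 R ℛ) :
    Finsupp.linearCombination R e x ∈ augIdeal 𝕜 R ℛ := by
  rw [Finsupp.linearCombination_apply]
  exact Submodule.sum_mem _ fun s _ => mul_mem_augIdeal_right ℛ (hx s) _

namespace SepExt

variable {𝕜 : Type} [Field 𝕜] {A : Type} [Ring A] [Algebra 𝕜 A]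
  {𝒜 : ℕ → Submodule 𝕜 A} {C : Type} [Ring C] [Algebra 𝕜 C] {𝒞 : ℕ → Submodule 𝕜 C}
  {κ₁ κ₂ : Type} [Fintype κ₁] [Fintype κ₂] [DecidableEq κ₁] [DecidableEq κ₂]
  (D : SepExt 𝒜 𝒞 κ₁ κ₂)

theorem α_proj [GradedAlgebra 𝒜] [GradedAlgebra 𝒞] (n : ℕ) (a : A) :
    D.α (GradedAlgebra.proj 𝒜 n a) = GradedAlgebra.proj 𝒞 n (D.α a) := by
  induction a using DirectSum.Decomposition.inductionOn 𝒜 with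
  | zero => simp
  | @homogeneous i a =>
    by_cases h : i = n
    · subst h
      rw [proj_of_mem 𝒜 a.2, proj_of_mem 𝒞 (D.α_mem _ _ a.2)]
    · rw [proj_of_mem_ne 𝒜 a.2 h, proj_of_mem_ne 𝒞 (D.α_mem _ _ a.2) h, map_zero]
  | add x y hx hy => simp only [map_add, hx, hy]

theorem α_mem_augIdeal [GradedAlgebra 𝒜] [GradedAlgebra 𝒞] {a : A} :
    D.α a ∈ augIdeal 𝕜 C 𝒞 ↔ a ∈ augIdeal 𝕜 A 𝒜 := by
  rw [mem_augIdeal, mem_augIdeal, ← α_proj, map_eq_zero_iff _ D.α_injective]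

theorem incl_fproj [GradedAlgebra 𝒜] [GradedAlgebra 𝒞] {σ : Type} (n : ℕ) (m : σ →₀ A) :
    D.incl σ (fproj 𝒜 σ n m) = fproj 𝒞 σ n (D.incl σ m) := by
  ext s; simp only [incl_apply, fproj_apply, α_proj]

/-- The extension of scalars of a map of free modules. -/
def ext {σ σ' : Type} (d : (σ →₀ A) →ₗ[A] (σ' →₀ A)) : (σ →₀ C) →ₗ[C] (σ' →₀ C) :=
  Finsupp.linearCombination C fun s => D.incl σ' (d (Finsupp.single s 1))

theorem ext_single {σ σ' : Type} (d : (σ →₀ A) →ₗ[A] (σ' →₀ A)) (s : σ) (c : C) :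
    D.ext d (Finsupp.single s c) = c • D.incl σ' (d (Finsupp.single s 1)) := by
  simp [ext]

theorem ext_incl {σ σ' : Type} (d : (σ →₀ A) →ₗ[A] (σ' →₀ A)) (m : σ →₀ A) :
    D.ext d (D.incl σ m) = D.incl σ' (d m) := by
  induction m using Finsupp.induction_linear with
  | zero => simp
  | add x y hx hy => simp only [map_add, hx, hy]
  | single s a =>
    rw [incl_single, ext_single, ← incl_smul, ← map_smul, Finsupp.smul_single, smul_eq_mul, mul_one]

theorem ext_ext {σ₁ σ₂ σ₃ : Type} (d : (σ₂ →₀ A) →ₗ[A] (σ₁ →₀ A))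
    (d' : (σ₃ →₀ A) →ₗ[A] (σ₂ →₀ A)) (h : ∀ m, d (d' m) = 0) (y : σ₃ →₀ C) :
    D.ext d (D.ext d' y) = 0 := by
  induction y using Finsupp.induction_linear with
  | zero => simp
  | add x y hx hy => simp only [map_add, hx, hy, add_zero]
  | single s c => rw [ext_single, map_smul, ext_incl, h, map_zero, smul_zero]

theorem ext_single_mem {σ σ' : Type} (d : (σ →₀ A) →ₗ[A] (σ' →₀ A))
    (hd : ∀ s t, d (Finsupp.single s 1) t ∈ 𝒜 1) (s : σ) (t : σ') :
    D.ext d (Finsupp.single s 1) t ∈ 𝒞 1 := by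
  rw [ext_single, one_smul, incl_apply]
  exact D.α_mem _ _ (hd s t)

/-- `β` is compatible with `d`: elements of `σ →₀ A` that are congruent, modulo the relations
attached to `β`, to an element of the `C`-module generated by the image of `d` lie in the image
of `d`. -/
def Compatible {σ₁ σ₂ : Type} (d : (σ₂ →₀ A) →ₗ[A] (σ₁ →₀ A)) (β : κ₁ → σ₁ → (σ₁ →₀ A)) : Prop :=
  (∀ k s t, β k s t ∈ 𝒜 1) ∧
    ∀ y m q, D.ext d y = D.incl σ₁ m + D.rel β q → m ∈ LinearMap.range d

/-- A compatible action on the target of `d` lifts along `d`. -/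
theorem exists_lift [GradedAlgebra 𝒜] [GradedAlgebra 𝒞] {σ₁ σ₂ : Type}
    (d : (σ₂ →₀ A) →ₗ[A] (σ₁ →₀ A)) (hd : ∀ s t, d (Finsupp.single s 1) t ∈ 𝒜 1)
    {β : κ₁ → σ₁ → (σ₁ →₀ A)} (hβ : D.Compatible d β) :
    ∃ β' : κ₁ → σ₂ → (σ₂ →₀ A), (∀ k s t, β' k s t ∈ 𝒜 1) ∧
      ∀ p, ∃ q, (∀ u, q u ∈ 𝒞 1) ∧ D.rel β q = D.ext d (D.rel β' (Finsupp.single p 1)) := by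
  have hX : ∀ k s, fproj 𝒞 σ₁ 2 (D.ext d (Finsupp.single s (D.w k))) =
      D.ext d (Finsupp.single s (D.w k)) := fun k s => fproj_of_mem 𝒞 fun t => by
    rw [ext_single, Finsupp.smul_apply, incl_apply, smul_eq_mul]
    exact SetLike.mul_mem_graded (D.w_mem k) (D.α_mem _ _ (hd s t))
  have hrel := D.rel_single_mem β hβ.1
  have hlift : ∀ (k : κ₁) (s : σ₂), ∃ m' q,
      D.ext d (Finsupp.single s (D.w (.inl k))) = D.incl σ₁ (d m') + D.rel β q := fun k s => by
    obtain ⟨m, q, h⟩ := D.exists_eq_incl_add_rel β (D.ext d (Finsupp.single s (D.w (.inl k))))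
    obtain ⟨m', rfl⟩ := hβ.2 _ m q h
    exact ⟨m', q, h⟩
  choose μ ν hμν using hlift
  refine ⟨fun k s => fproj 𝒜 σ₂ 1 (μ k s), fun k s t => fproj_mem 𝒜 1 _ t, ?_⟩
  rintro ⟨k | k, s⟩
  · refine ⟨fproj 𝒞 _ 1 (ν k s), fun u => fproj_mem 𝒞 1 _ u, ?_⟩
    rw [map_fproj 𝒞 _ hrel, rel_single_inl, one_mul, one_smul, map_sub, ext_incl,
      map_fproj 𝒜 _ hd, incl_fproj, ← hX, ← map_sub]
    rw [hμν, add_sub_cancel_left]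
  · obtain ⟨q, hq⟩ : ∃ q, D.rel β q = D.ext d (Finsupp.single s (D.w (.inr k))) := by
      choose f hf using D.inr_mul k
      refine ⟨(d (Finsupp.single s 1)).sum fun t a => ∑ l, Finsupp.single (.inr l, t) (f a l), ?_⟩
      rw [map_finsuppSum, ext_single]
      conv_rhs => rw [← Finsupp.sum_single (d (Finsupp.single s 1)), map_finsuppSum,
        Finsupp.smul_sum]
      refine Finsupp.sum_congr fun t _ => ?_
      rw [map_sum, incl_single, Finsupp.smul_single, smul_eq_mul, hf, Finsupp.single_finsetSum]
      exact Finset.sum_congr rfl fun l _ => D.rel_single_inr β l t _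
    refine ⟨fproj 𝒞 _ 1 q, fun u => fproj_mem 𝒞 1 _ u, ?_⟩
    rw [map_fproj 𝒞 _ hrel, hq, rel_single_inr, one_mul, hX]

theorem exists_rel_eq_ext {σ₁ σ₂ : Type} {d : (σ₂ →₀ A) →ₗ[A] (σ₁ →₀ A)}
    {β : κ₁ → σ₁ → (σ₁ →₀ A)} {β' : κ₁ → σ₂ → (σ₂ →₀ A)}
    (g : ((κ₁ ⊕ κ₂) × σ₂ →₀ C) →ₗ[C] ((κ₁ ⊕ κ₂) × σ₁ →₀ C))
    (hg : ∀ p, D.rel β (g (Finsupp.single p 1)) = D.ext d (D.rel β' (Finsupp.single p 1)))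
    (q : (κ₁ ⊕ κ₂) × σ₂ →₀ C) : D.rel β (g q) = D.ext d (D.rel β' q) := by
  have : D.rel β ∘ₗ g = D.ext d ∘ₗ D.rel β' := by
    refine Finsupp.lhom_ext' fun p => LinearMap.ext_ring ?_
    exact hg p
  exact LinearMap.congr_fun this q

theorem compatible_succ {σ₁ σ₂ σ₃ : Type} {d : (σ₂ →₀ A) →ₗ[A] (σ₁ →₀ A)}
    {d' : (σ₃ →₀ A) →ₗ[A] (σ₂ →₀ A)} (hex : LinearMap.ker d = LinearMap.range d')
    {β : κ₁ → σ₁ → (σ₁ →₀ A)} {β' : κ₁ → σ₂ → (σ₂ →₀ A)} (hβ' : ∀ k s t, β' k s t ∈ 𝒜 1)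
    (h : ∀ q, ∃ q', D.rel β q' = D.ext d (D.rel β' q)) : D.Compatible d' β' := by
  refine ⟨hβ', fun y m q hy => ?_⟩
  obtain ⟨q', hq'⟩ := h q
  have := congrArg (D.ext d) hy
  rw [D.ext_ext d d' (fun m => by
      rw [← LinearMap.mem_ker, hex]; exact LinearMap.mem_range_self d' m), map_add, ext_incl,
    ← hq'] at this
  rw [← hex, LinearMap.mem_ker]
  refine (D.eq_zero_of_rel_eq_incl β (q := -q') ?_).2
  rw [map_neg]
  exact (eq_neg_of_add_eq_zero_left this.symm).symm

theorem exists_seq {X : ℕ → Type} {P : ∀ i, X i → Prop} {Q : ∀ i, X i → X (i + 1) → Prop}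
    (h₀ : ∃ x, P 0 x) (h : ∀ i x, P i x → ∃ y, P (i + 1) y ∧ Q i x y) :
    ∃ x : ∀ i, X i, (∀ i, P i (x i)) ∧ ∀ i, Q i (x i) (x (i + 1)) := by
  obtain ⟨x₀, hx₀⟩ := h₀
  choose next hP hQ using h
  let s : ∀ i, {x : X i // P i x} := fun i =>
    Nat.rec ⟨x₀, hx₀⟩ (fun i x => ⟨next i x.1 x.2, hP i x.1 x.2⟩) i
  exact ⟨fun i => (s i).1, fun i => (s i).2, fun i => hQ i (s i).1 (s i).2⟩

/-- An extension of the above type of a Koszul algebra is Koszul. -/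
theorem isKoszul (D : SepExt 𝒜 𝒞 κ₁ κ₂) [GradedAlgebra 𝒜] [GradedAlgebra 𝒞]
    (h : IsKoszul 𝕜 A 𝒜) : IsKoszul 𝕜 C 𝒞 := by
  obtain ⟨σ, d, ε, hεs, hε, hex, hdgr, _⟩ := h
  have hd : ∀ i s t, d i (Finsupp.single s 1) t ∈ 𝒜 1 := fun i =>
    map_single_mem_of_freeGrade 𝒜 (d i) i (hdgr i)
  have hdd : ∀ i m, d i (d (i + 1) m) = 0 := fun i m => by
    rw [← LinearMap.mem_ker, hex]; exact LinearMap.mem_range_self _ _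
  obtain ⟨e, he⟩ : ∃ e : σ 0 → A, ∀ s,
      (augIdeal 𝕜 A 𝒜).mkQ (e s) = ε (Finsupp.single s 1) :=
    ⟨fun s => ((augIdeal 𝕜 A 𝒜).mkQ_surjective (ε (Finsupp.single s 1))).choose,
      fun s => ((augIdeal 𝕜 A 𝒜).mkQ_surjective (ε (Finsupp.single s 1))).choose_spec⟩
  have hεe : ∀ m, ε m = (augIdeal 𝕜 A 𝒜).mkQ (Finsupp.linearCombination A e m) := by
    intro m
    have : ε = (augIdeal 𝕜 A 𝒜).mkQ ∘ₗ Finsupp.linearCombination A e := by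
      refine Finsupp.lhom_ext' fun s => LinearMap.ext_ring ?_
      simp only [LinearMap.comp_apply, Finsupp.lsingle_apply, Finsupp.linearCombination_single,
        one_smul, he]
    exact LinearMap.congr_fun this m
  set E := Finsupp.linearCombination C fun s => D.α (e s) with hE
  have hEincl : ∀ m, E (D.incl _ m) = D.α (Finsupp.linearCombination A e m) := by
    intro m
    induction m using Finsupp.induction_linear with
    | zero => simp
    | add x y hx hy => simp only [map_add, hx, hy]
    | single s a => simp [hE]
  have hmem : ∀ m, E (D.incl _ m) ∈ augIdeal 𝕜 C 𝒞 ↔ m ∈ LinearMap.range (d 0) := by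
    intro m
    rw [hEincl, α_mem_augIdeal, ← hε, LinearMap.mem_ker, hεe, ← LinearMap.mem_ker,
      Submodule.ker_mkQ]
  have hL : ∀ {τ : Type} (L : (τ →₀ C) →ₗ[C] (σ 0 →₀ C)),
      (∀ s t, L (Finsupp.single s 1) t ∈ 𝒞 1) → ∀ x, E (L x) ∈ augIdeal 𝕜 C 𝒞 := fun L hL x =>
    linearCombination_mem_augIdeal 𝒞 _ (linearMap_coeff_mem_augIdeal 𝒞 L hL x)
  obtain ⟨β, hβ, hββ⟩ := exists_seq (X := fun i => κ₁ → σ i → (σ i →₀ A))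
    (P := fun i β => D.Compatible (d i) β)
    (Q := fun i β β' => ∀ p, ∃ q, (∀ u, q u ∈ 𝒞 1) ∧
      D.rel β q = D.ext (d i) (D.rel β' (Finsupp.single p 1)))
    (by
      have h0 : ∀ (k : κ₁) (s t : σ 0), (0 : κ₁ → σ 0 → (σ 0 →₀ A)) k s t ∈ 𝒜 1 := by simp
      refine ⟨0, h0, fun y m q hy => ?_⟩
      rw [← hmem, ← sub_eq_iff_eq_add.2 hy, map_sub]
      exact sub_mem (hL _ (D.ext_single_mem _ (hd 0)) y) (hL _ (D.rel_single_mem _ h0) q))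
    (by
      intro i β hβ
      obtain ⟨β', hβ', hq⟩ := D.exists_lift (d i) (hd i) hβ
      refine ⟨β', D.compatible_succ (β := β) (hex i) hβ' fun q => ?_, hq⟩
      choose γ hγ using hq
      refine ⟨Finsupp.linearCombination C γ q, ?_⟩
      refine D.exists_rel_eq_ext _ (fun p => ?_) q
      rw [Finsupp.linearCombination_single, one_smul, (hγ p).2])
  choose γ hγ1 hγ using hββ
  have hg : ∀ i q, D.rel (β i) (Finsupp.linearCombination C (γ i) q) =
      D.ext (d i) (D.rel (β (i + 1)) q) := fun i =>
    D.exists_rel_eq_ext _ fun p => by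
      rw [Finsupp.linearCombination_single, one_smul, hγ]
  have hF1 : ∀ i s t, D.ext (d i) (Finsupp.single s 1) t ∈ 𝒞 1 := fun i =>
    D.ext_single_mem _ (hd i)
  have hr1 : ∀ i p t, D.rel (β i) (Finsupp.single p 1) t ∈ 𝒞 1 := fun i =>
    D.rel_single_mem _ (hβ i).1
  have hD1 : ∀ i p t, totD (fun i => D.ext (d i)) (fun i => D.rel (β i))
      (fun i => Finsupp.linearCombination C (γ i)) i (Finsupp.single p 1) t ∈ 𝒞 1 :=
    totD_single_mem (s := (𝒞 1).toAddSubgroup) hF1 hr1 fun i p t => by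
      rw [Finsupp.linearCombination_single, one_smul]
      exact hγ1 i p t
  have hker : ∀ x, ((augIdeal 𝕜 C 𝒞).mkQ ∘ₗ E) x = 0 ↔ E x ∈ augIdeal 𝕜 C 𝒞 := fun x => by
    rw [LinearMap.comp_apply, ← LinearMap.mem_ker, Submodule.ker_mkQ]
  have hsurj : Function.Surjective ((augIdeal 𝕜 C 𝒞).mkQ ∘ₗ E) := by
    intro x
    obtain ⟨c, rfl⟩ := (augIdeal 𝕜 C 𝒞).mkQ_surjective x
    obtain ⟨m, hm⟩ := hεs ((augIdeal 𝕜 A 𝒜).mkQ (D.π c))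
    refine ⟨D.incl _ m, ?_⟩
    rw [hεe, ← sub_eq_zero, ← map_sub, ← LinearMap.mem_ker, Submodule.ker_mkQ,
      ← D.α_mem_augIdeal (𝒞 := 𝒞), map_sub, ← hEincl] at hm
    rw [LinearMap.comp_apply, ← sub_eq_zero, ← map_sub, ← LinearMap.mem_ker, Submodule.ker_mkQ]
    rw [D.expand c, ← sub_sub]
    exact sub_mem hm (Submodule.sum_mem _ fun k _ =>
      (augIdeal 𝕜 C 𝒞).smul_mem _ (Submodule.subset_span ⟨1, one_pos, D.w_mem k⟩))
  have haug : LinearMap.ker ((augIdeal 𝕜 C 𝒞).mkQ ∘ₗ E) =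
      LinearMap.range (coneEnd (D.ext (d 0)) (D.rel (β 0))) := by
    refine le_antisymm ?_ ?_
    · intro x hx
      rw [LinearMap.mem_ker, hker] at hx
      obtain ⟨m, q, rfl⟩ := D.exists_eq_incl_add_rel (β 0) x
      rw [map_add, Submodule.add_mem_iff_left _ (hL _ (hr1 0) q), hmem] at hx
      obtain ⟨m', rfl⟩ := hx
      refine ⟨(Finsupp.sumFinsuppLEquivProdFinsupp C).symm (D.incl _ m', q), ?_⟩
      rw [coneEnd_symm, ext_incl]
    · rintro _ ⟨x, rfl⟩
      rw [LinearMap.mem_ker, hker]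
      exact hL _ (hD1 0) x
  have hdeg : ∀ n, 0 < n → ∀ x ∈ freeGrade 𝕜 C 𝒞 0 (σ 0) n,
      ((augIdeal 𝕜 C 𝒞).mkQ ∘ₗ E) x = 0 := by
    intro n hn x hx
    rw [mem_freeGrade] at hx
    rw [hker]
    refine linearCombination_mem_augIdeal 𝒞 _ fun s => Submodule.subset_span ⟨n, hn, ?_⟩
    have := hx s
    rwa [if_pos (Nat.zero_le n), Nat.sub_zero] at this
  refine ⟨totIndex (κ₁ ⊕ κ₂) σ, totD (fun i => D.ext (d i)) (fun i => D.rel (β i))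
      (fun i => Finsupp.linearCombination C (γ i)), (augIdeal 𝕜 C 𝒞).mkQ ∘ₗ E, hsurj, haug, ?_,
      fun i n x hx => map_mem_freeGrade 𝒞 _ (hD1 i) i n x hx, hdeg⟩
  refine totD_exact (fun i => D.rel_injective _) hg (fun i => D.ext_ext _ _ (hdd i)) ?_
  intro i p q hpq
  obtain ⟨m, q', rfl⟩ := D.exists_eq_incl_add_rel (β (i + 1)) p
  rw [map_add, ext_incl, ← hg, ← eq_sub_iff_add_eq, ← map_sub] at hpq
  have hm := (D.eq_zero_of_rel_eq_incl _ hpq.symm).2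
  rw [← LinearMap.mem_ker, hex] at hm
  obtain ⟨m', rfl⟩ := hm
  exact ⟨D.incl _ m', q', by rw [ext_incl]⟩

end SepExt

section TensorCoordinates

variable {𝕜 : Type} [Field 𝕜] {W : Type} [AddCommGroup W] [Module 𝕜 W] {κ : Type}

/-- Left multiplication by a vector on `T(W) = 𝕜 ⊕ ⨁ₖ T(W) bₖ`. -/
def coordAction (b : Module.Basis κ 𝕜 W) :
    W →ₗ[𝕜] Module.End 𝕜 (𝕜 × (κ → TensorAlgebra 𝕜 W)) :=
  LinearMap.mk₂ 𝕜 (fun w x =>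
      (0, fun k => x.1 • algebraMap 𝕜 (TensorAlgebra 𝕜 W) (b.repr w k) +
        TensorAlgebra.ι 𝕜 w * x.2 k))
    (fun w w' x => by
      ext k
      · simp
      · simp only [map_add, Finsupp.add_apply, smul_add, add_mul, Prod.snd_add, Pi.add_apply]
        abel)
    (fun c w x => by
      ext k
      · simp
      · simp only [map_smul, Finsupp.smul_apply, smul_eq_mul, map_mul]
        change _ = c • (x.1 • algebraMap 𝕜 (TensorAlgebra 𝕜 W) (b.repr w k) +
          TensorAlgebra.ι 𝕜 w * x.2 k)
        rw [smul_add, smul_mul_assoc, ← Algebra.smul_def, smul_comm])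
    (fun w x y => by
      ext k
      · simp
      · simp only [Prod.fst_add, Prod.snd_add, Pi.add_apply, add_smul, mul_add]
        abel)
    (fun c w x => by
      ext k
      · simp
      · simp [mul_smul, smul_add])

/-- The linear isomorphism `T(W) → 𝕜 ⊕ ⨁ₖ T(W)` inverse to `(r, q) ↦ r + ∑ qₖ bₖ`. -/
def coord (b : Module.Basis κ 𝕜 W) : TensorAlgebra 𝕜 W →ₗ[𝕜] 𝕜 × (κ → TensorAlgebra 𝕜 W) :=
  (LinearMap.applyₗ (1, 0)) ∘ₗ (TensorAlgebra.lift 𝕜 (coordAction b)).toLinearMap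

theorem coord_apply (b : Module.Basis κ 𝕜 W) (t : TensorAlgebra 𝕜 W) :
    coord b t = TensorAlgebra.lift 𝕜 (coordAction b) t (1, 0) := rfl

theorem coord_algebraMap (b : Module.Basis κ 𝕜 W) (r : 𝕜) :
    coord b (algebraMap 𝕜 _ r) = (r, 0) := by
  rw [coord_apply, AlgHom.commutes, Module.algebraMap_end_apply]
  ext <;> simp

theorem lift_coordAction_zero (b : Module.Basis κ 𝕜 W) (t : TensorAlgebra 𝕜 W)
    (q : κ → TensorAlgebra 𝕜 W) :
    TensorAlgebra.lift 𝕜 (coordAction b) t (0, q) = (0, fun k => t * q k) := by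
  induction t using TensorAlgebra.induction generalizing q with
  | algebraMap r =>
    rw [AlgHom.commutes, Module.algebraMap_end_apply]
    ext <;> simp [Algebra.smul_def]
  | ι w =>
    rw [TensorAlgebra.lift_ι_apply]
    ext <;> simp [coordAction]
  | mul x y hx hy => rw [map_mul, Module.End.mul_apply, hy, hx]; simp only [mul_assoc]
  | add x y hx hy => rw [map_add, LinearMap.add_apply, hx, hy]; ext <;> simp [add_mul]

theorem coord_mul_ι [DecidableEq κ] (b : Module.Basis κ 𝕜 W) (t : TensorAlgebra 𝕜 W) (l : κ) :
    coord b (t * TensorAlgebra.ι 𝕜 (b l)) = (0, fun k => if k = l then t else 0) := by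
  rw [coord_apply, map_mul, Module.End.mul_apply, TensorAlgebra.lift_ι_apply]
  have : coordAction b (b l) (1, 0) = (0, fun k => if k = l then 1 else 0) := by
    ext k
    · simp [coordAction]
    · simp only [coordAction, LinearMap.mk₂_apply, Module.Basis.repr_self, Finsupp.single_apply]
      by_cases h : l = k <;> simp [h, eq_comm]
  rw [this, lift_coordAction_zero]
  simp

theorem eq_coord [Fintype κ] (b : Module.Basis κ 𝕜 W) (t : TensorAlgebra 𝕜 W) :
    t = algebraMap 𝕜 _ (coord b t).1 + ∑ k, (coord b t).2 k * TensorAlgebra.ι 𝕜 (b k) := by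
  have key : ∀ (t : TensorAlgebra 𝕜 W) (x : 𝕜 × (κ → TensorAlgebra 𝕜 W)),
      t * (algebraMap 𝕜 _ x.1 + ∑ k, x.2 k * TensorAlgebra.ι 𝕜 (b k)) =
        algebraMap 𝕜 _ (TensorAlgebra.lift 𝕜 (coordAction b) t x).1 +
          ∑ k, (TensorAlgebra.lift 𝕜 (coordAction b) t x).2 k * TensorAlgebra.ι 𝕜 (b k) := by
    intro t
    induction t using TensorAlgebra.induction with
    | algebraMap r =>
      intro x
      rw [AlgHom.commutes, Module.algebraMap_end_apply]
      simp [Algebra.smul_def, mul_add, Finset.mul_sum, mul_assoc]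
    | ι w =>
      intro x
      rw [TensorAlgebra.lift_ι_apply]
      conv_lhs => rw [mul_add, ← Algebra.commutes, ← Algebra.smul_def]
      conv_lhs => enter [1, 2]; rw [← b.sum_repr w]
      simp only [coordAction, LinearMap.mk₂_apply, map_zero, zero_add, add_mul,
        Finset.sum_add_distrib, Finset.mul_sum, mul_assoc, map_sum, map_smul,
        Algebra.smul_def]
    | mul x y hx hy =>
      intro z
      rw [mul_assoc, hy, hx, map_mul, Module.End.mul_apply]
    | add x y hx hy =>
      intro z
      rw [add_mul, hx, hy, map_add, LinearMap.add_apply]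
      simp only [Prod.fst_add, Prod.snd_add, Pi.add_apply, map_add, add_mul,
        Finset.sum_add_distrib]
      abel
  simpa [coord_apply] using key t (1, 0)

end TensorCoordinates

section Realization

variable {𝕜 : Type} [Field 𝕜] {A B : Type} [Ring A] [Algebra 𝕜 A] [Ring B] [Algebra 𝕜 B]
  {τ : B ⊗[𝕜] A →ₗ[𝕜] A ⊗[𝕜] B} {C : Type} [Ring C] [Algebra 𝕜 C] {ψ : A ⊗[𝕜] B →ₗ[𝕜] C}

theorem mulTau_tmul (a a' : A) (b b' : B) :
    mulTau 𝕜 A B τ ((a ⊗ₜ b) ⊗ₜ (a' ⊗ₜ b')) =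
      TensorProduct.map (LinearMap.mulLeft 𝕜 a) (LinearMap.mulRight 𝕜 b') (τ (b ⊗ₜ a')) := by
  simp only [mulTau, LinearMap.comp_apply, LinearEquiv.coe_coe, TensorProduct.assoc_tmul,
    LinearMap.lTensor_tmul, TensorProduct.assoc_symm_tmul, LinearMap.rTensor_tmul]
  induction τ (b ⊗ₜ a') with
  | zero => simp
  | tmul x y => simp
  | add x y hx hy => simp only [add_tmul, tmul_add, map_add, hx, hy]

namespace Realizes

/-- The inclusion of the left factor of a twisted tensor product. -/
def left (h : Realizes 𝕜 A B τ C ψ) (hτ : IsTwisting 𝕜 A B τ) : A →ₐ[𝕜] C :=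
  AlgHom.ofLinearMap (ψ ∘ₗ (TensorProduct.mk 𝕜 A B).flip 1) h.2.1 fun a a' => by
    change ψ _ = ψ _ * ψ _
    rw [← h.2.2, LinearMap.flip_apply, LinearMap.flip_apply, LinearMap.flip_apply,
      TensorProduct.mk_apply, TensorProduct.mk_apply, TensorProduct.mk_apply, mulTau_tmul, hτ.1]
    simp

/-- The inclusion of the right factor of a twisted tensor product. -/
def right (h : Realizes 𝕜 A B τ C ψ) (hτ : IsTwisting 𝕜 A B τ) : B →ₐ[𝕜] C :=
  AlgHom.ofLinearMap (ψ ∘ₗ TensorProduct.mk 𝕜 A B 1) h.2.1 fun b b' => by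
    change ψ _ = ψ _ * ψ _
    rw [← h.2.2, TensorProduct.mk_apply, TensorProduct.mk_apply, TensorProduct.mk_apply,
      mulTau_tmul, hτ.2.1]
    simp

variable (h : Realizes 𝕜 A B τ C ψ) (hτ : IsTwisting 𝕜 A B τ)

theorem left_apply (a : A) : h.left hτ a = ψ (a ⊗ₜ 1) := rfl

theorem right_apply (b : B) : h.right hτ b = ψ (1 ⊗ₜ b) := rfl

theorem left_mul_right (a : A) (b : B) : h.left hτ a * h.right hτ b = ψ (a ⊗ₜ b) := by
  rw [left_apply, right_apply, ← h.2.2, mulTau_tmul, hτ.1]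
  simp

theorem right_mul_left (b : B) (a : A) : h.right hτ b * h.left hτ a = ψ (τ (b ⊗ₜ a)) := by
  rw [left_apply, right_apply, ← h.2.2, mulTau_tmul, LinearMap.mulLeft_one, LinearMap.mulRight_one,
    TensorProduct.map_id, LinearMap.id_apply]

/-- The linear equivalence underlying a realization. -/
def equiv (h : Realizes 𝕜 A B τ C ψ) : A ⊗[𝕜] B ≃ₗ[𝕜] C := LinearEquiv.ofBijective ψ h.1

theorem equiv_symm_apply (h : Realizes 𝕜 A B τ C ψ) (x : A ⊗[𝕜] B) : h.equiv.symm (ψ x) = x :=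
  h.equiv.symm_apply_apply x

theorem induction {P : C → Prop} (hadd : ∀ x y, P x → P y → P (x + y))
    (hmul : ∀ a b, P (h.left hτ a * h.right hτ b)) (c : C) : P c := by
  obtain ⟨x, rfl⟩ := h.1.2 c
  induction x with
  | zero => simpa using hmul 0 0
  | tmul a b => rw [← h.left_mul_right hτ]; exact hmul a b
  | add x y hx hy => rw [map_add]; exact hadd _ _ hx hy

end Realizes

theorem map_subTmul_le {M N P : Type} [AddCommGroup M] [Module 𝕜 M] [AddCommGroup N] [Module 𝕜 N]
    [AddCommGroup P] [Module 𝕜 P] {p : Submodule 𝕜 M} {q : Submodule 𝕜 N} {f : M ⊗[𝕜] N →ₗ[𝕜] P}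
    {S : Submodule 𝕜 P} (hf : ∀ m ∈ p, ∀ n ∈ q, f (m ⊗ₜ n) ∈ S) :
    (subTmul 𝕜 p q).map f ≤ S := by
  rintro _ ⟨_, ⟨x, rfl⟩, rfl⟩
  induction x with
  | zero => simp
  | tmul m n => exact hf _ m.2 _ n.2
  | add x y hx hy => rw [map_add, map_add]; exact add_mem hx hy

theorem tmul_mem_subTmul {M N : Type} [AddCommGroup M] [Module 𝕜 M] [AddCommGroup N] [Module 𝕜 N]
    {p : Submodule 𝕜 M} {q : Submodule 𝕜 N} {m : M} {n : N} (hm : m ∈ p) (hn : n ∈ q) :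
    m ⊗ₜ n ∈ subTmul 𝕜 p q :=
  ⟨⟨m, hm⟩ ⊗ₜ ⟨n, hn⟩, rfl⟩

theorem tmul_mem_kunneth {M N : Type} [AddCommGroup M] [Module 𝕜 M] [AddCommGroup N] [Module 𝕜 N]
    {ℳ : ℕ → Submodule 𝕜 M} {𝒩 : ℕ → Submodule 𝕜 N} {i j n : ℕ} (hij : i + j = n) {x : M} {y : N}
    (hx : x ∈ ℳ i) (hy : y ∈ 𝒩 j) : x ⊗ₜ y ∈ kunneth 𝕜 ℳ 𝒩 n :=
  Submodule.mem_iSup_of_mem (i, j) (Submodule.mem_iSup_of_mem hij (tmul_mem_subTmul hx hy))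

theorem map_kunneth_le {M N P : Type} [AddCommGroup M] [Module 𝕜 M] [AddCommGroup N] [Module 𝕜 N]
    [AddCommGroup P] [Module 𝕜 P] {ℳ : ℕ → Submodule 𝕜 M} {𝒩 : ℕ → Submodule 𝕜 N} {n : ℕ}
    {f : M ⊗[𝕜] N →ₗ[𝕜] P} {S : Submodule 𝕜 P}
    (hf : ∀ i j, i + j = n → ∀ x ∈ ℳ i, ∀ y ∈ 𝒩 j, f (x ⊗ₜ y) ∈ S) :
    (kunneth 𝕜 ℳ 𝒩 n).map f ≤ S := by
  simp only [kunneth, Submodule.map_iSup, iSup_le_iff]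
  exact fun ij hij => map_subTmul_le (hf _ _ hij)

theorem isInternal_of_projections {M : Type} [AddCommGroup M] [Module 𝕜 M] {ℳ : ℕ → Submodule 𝕜 M}
    (pr : ℕ → M →ₗ[𝕜] M) (h₁ : ∀ n, ∀ x ∈ ℳ n, pr n x = x)
    (h₀ : ∀ m n, m ≠ n → ∀ x ∈ ℳ m, pr n x = 0) (htop : ⨆ n, ℳ n = ⊤) : IsInternal ℳ := by
  rw [isInternal_submodule_iff_iSupIndep_and_iSup_eq_top]
  refine ⟨fun n => ?_, htop⟩
  rw [Submodule.disjoint_def]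
  intro x hx hx'
  rw [← h₁ n x hx, ← LinearMap.mem_ker]
  refine (iSup₂_le fun m hm => ?_ : ⨆ (m) (_ : m ≠ n), ℳ m ≤ LinearMap.ker (pr n)) hx'
  exact fun y hy => h₀ m n hm y hy

theorem left_mul_right_mem {𝒜 : ℕ → Submodule 𝕜 A} {ℬ : ℕ → Submodule 𝕜 B}
    (hτ : IsTwisting 𝕜 A B τ) (h : Realizes 𝕜 A B τ C ψ) {i j n : ℕ}
    (hij : i + j = n) {a : A} {b : B} (ha : a ∈ 𝒜 i) (hb : b ∈ ℬ j) :
    h.left hτ a * h.right hτ b ∈ (kunneth 𝕜 𝒜 ℬ n).map ψ := by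
  rw [h.left_mul_right]
  exact Submodule.mem_map_of_mem (tmul_mem_kunneth hij ha hb)

variable (𝒜 : ℕ → Submodule 𝕜 A) (ℬ : ℕ → Submodule 𝕜 B) [GradedAlgebra 𝒜] [GradedAlgebra ℬ]

theorem isInternal_map_kunneth (h : Realizes 𝕜 A B τ C ψ) :
    IsInternal fun n => (kunneth 𝕜 𝒜 ℬ n).map ψ := by
  have key : ∀ i j p, ∀ x ∈ 𝒜 i, ∀ y ∈ ℬ j,
      TensorProduct.map (GradedAlgebra.proj 𝒜 p.1) (GradedAlgebra.proj ℬ p.2) (x ⊗ₜ y) =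
        if p = (i, j) then x ⊗ₜ[𝕜] y else 0 := by
    intro i j p x hx y hy
    rw [TensorProduct.map_tmul]
    split_ifs with hp
    · rw [hp, proj_of_mem 𝒜 hx, proj_of_mem ℬ hy]
    · by_cases hi : i = p.1
      · rw [proj_of_mem_ne ℬ hy (fun hj => hp (Prod.ext hi.symm hj.symm)), tmul_zero]
      · rw [proj_of_mem_ne 𝒜 hx hi, zero_tmul]
  let pr : ℕ → C →ₗ[𝕜] C := fun n => ψ ∘ₗ (∑ p ∈ Finset.HasAntidiagonal.antidiagonal n,
    TensorProduct.map (GradedAlgebra.proj 𝒜 p.1) (GradedAlgebra.proj ℬ p.2)) ∘ₗ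
      h.equiv.symm.toLinearMap
  have hpr : ∀ n i j, ∀ x ∈ 𝒜 i, ∀ y ∈ ℬ j,
      pr n (ψ (x ⊗ₜ y)) = if i + j = n then ψ (x ⊗ₜ y) else 0 := by
    intro n i j x hx y hy
    simp only [pr, LinearMap.comp_apply, LinearEquiv.coe_coe, h.equiv_symm_apply,
      LinearMap.sum_apply, key i j _ x hx y hy, Finset.sum_ite_eq', Finset.HasAntidiagonal.mem_antidiagonal]
    split_ifs <;> simp
  refine isInternal_of_projections pr ?_ ?_ ?_
  · intro n
    have : (kunneth 𝕜 𝒜 ℬ n).map ψ ≤ LinearMap.eqLocus (pr n) LinearMap.id :=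
      map_kunneth_le fun i j hij x hx y hy => by
        rw [LinearMap.mem_eqLocus, hpr n i j x hx y hy, if_pos hij, LinearMap.id_apply]
    exact fun x hx => this hx
  · intro m n hmn
    have : (kunneth 𝕜 𝒜 ℬ m).map ψ ≤ LinearMap.ker (pr n) :=
      map_kunneth_le fun i j hij x hx y hy => by
        rw [LinearMap.mem_ker, hpr n i j x hx y hy, if_neg (hij ▸ hmn)]
    exact fun x hx => this hx
  · rw [eq_top_iff, ← LinearMap.range_eq_top.2 h.1.2]
    rintro _ ⟨x, rfl⟩
    induction x with
    | zero => simp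
    | add x y hx hy => rw [map_add]; exact add_mem hx hy
    | tmul x y =>
      induction x using DirectSum.Decomposition.inductionOn 𝒜 with
      | zero => simp
      | add x x' hx hx' => rw [add_tmul, map_add]; exact add_mem hx hx'
      | @homogeneous i x =>
        induction y using DirectSum.Decomposition.inductionOn ℬ with
        | zero => simp
        | add y y' hy hy' => rw [tmul_add, map_add]; exact add_mem hy hy'
        | @homogeneous j y =>
          exact Submodule.mem_iSup_of_mem (i + j)
            (Submodule.mem_map_of_mem (tmul_mem_kunneth rfl x.2 y.2))

theorem left_mul_mul_right_mem (hτ : IsTwisting 𝕜 A B τ) (h : Realizes 𝕜 A B τ C ψ) {i j m n : ℕ}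
    (hn : i + m + j = n) {a : A} {b : B} (ha : a ∈ 𝒜 i) (hb : b ∈ ℬ j) {x : C}
    (hx : x ∈ (kunneth 𝕜 𝒜 ℬ m).map ψ) :
    h.left hτ a * x * h.right hτ b ∈ (kunneth 𝕜 𝒜 ℬ n).map ψ := by
  suffices (kunneth 𝕜 𝒜 ℬ m).map ψ ≤ ((kunneth 𝕜 𝒜 ℬ n).map ψ).comap
      (LinearMap.mulRight 𝕜 (h.right hτ b) ∘ₗ LinearMap.mulLeft 𝕜 (h.left hτ a)) from this hx
  refine map_kunneth_le fun k l hkl u hu v hv => ?_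
  rw [Submodule.mem_comap, LinearMap.comp_apply, LinearMap.mulLeft_apply, LinearMap.mulRight_apply,
    ← h.left_mul_right hτ, ← mul_assoc, ← map_mul, mul_assoc, ← map_mul]
  exact left_mul_right_mem hτ h (by omega) (SetLike.mul_mem_graded ha hu)
    (SetLike.mul_mem_graded hv hb)

theorem mul_mem_map_kunneth (hτ : IsGradedTwisting 𝕜 A B 𝒜 ℬ τ) (h : Realizes 𝕜 A B τ C ψ)
    {m n : ℕ} {x y : C} (hx : x ∈ (kunneth 𝕜 𝒜 ℬ m).map ψ) (hy : y ∈ (kunneth 𝕜 𝒜 ℬ n).map ψ) :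
    x * y ∈ (kunneth 𝕜 𝒜 ℬ (m + n)).map ψ := by
  suffices (kunneth 𝕜 𝒜 ℬ m).map ψ ≤
      ((kunneth 𝕜 𝒜 ℬ (m + n)).map ψ).comap (LinearMap.mulRight 𝕜 y) from this hx
  refine map_kunneth_le fun i j hij a ha b hb => ?_
  suffices (kunneth 𝕜 𝒜 ℬ n).map ψ ≤
      ((kunneth 𝕜 𝒜 ℬ (m + n)).map ψ).comap (LinearMap.mulLeft 𝕜 (ψ (a ⊗ₜ b))) from this hy
  refine map_kunneth_le fun i' j' hij' a' ha' b' hb' => ?_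
  rw [Submodule.mem_comap, LinearMap.mulLeft_apply, ← h.left_mul_right hτ.1,
    ← h.left_mul_right hτ.1, mul_assoc, ← mul_assoc (h.right hτ.1 b), h.right_mul_left, ← mul_assoc]
  exact left_mul_mul_right_mem 𝒜 ℬ (m := j + i') hτ.1 h (by omega) ha hb' (Submodule.mem_map_of_mem
    (hτ.2 _ (Submodule.mem_map_of_mem (tmul_mem_kunneth rfl hb ha'))))

theorem gradedMonoid_map_kunneth (hτ : IsGradedTwisting 𝕜 A B 𝒜 ℬ τ) (h : Realizes 𝕜 A B τ C ψ) :
    SetLike.GradedMonoid fun n => (kunneth 𝕜 𝒜 ℬ n).map ψ where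
  one_mem := by
    rw [← h.2.1]
    exact Submodule.mem_map_of_mem (tmul_mem_kunneth (zero_add 0) (SetLike.one_mem_graded 𝒜)
      (SetLike.one_mem_graded ℬ))
  mul_mem := fun _ _ _ _ hx hy => mul_mem_map_kunneth 𝒜 ℬ hτ h hx hy

/-- A twisted tensor product of graded algebras is graded. -/
@[reducible] def gradedAlgebraOfRealizes (hτ : IsGradedTwisting 𝕜 A B 𝒜 ℬ τ)
    (h : Realizes 𝕜 A B τ C ψ) : GradedAlgebra fun n => (kunneth 𝕜 𝒜 ℬ n).map ψ :=
  letI := gradedMonoid_map_kunneth 𝒜 ℬ hτ h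
  letI := (isInternal_map_kunneth 𝒜 ℬ h).chooseDecomposition
  { }

end Realization

section Separable

variable {𝕜 : Type} [Field 𝕜] {A : Type} [Ring A] [Algebra 𝕜 A] {𝒜 : ℕ → Submodule 𝕜 A}
  {W : Type} [AddCommGroup W] [Module 𝕜 W]
  {τ : TensorAlgebra 𝕜 W ⊗[𝕜] A →ₗ[𝕜] A ⊗[𝕜] TensorAlgebra 𝕜 W}
  {C : Type} [Ring C] [Algebra 𝕜 C] {ψ : A ⊗[𝕜] TensorAlgebra 𝕜 W →ₗ[𝕜] C}
  {κ κ₁ κ₂ : Type}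

/-- Induction for an algebra generated in degree one. -/
theorem induction_of_surjective_canMap (hA : Function.Surjective (canMap 𝕜 A 𝒜)) {P : A → Prop}
    (hscalar : ∀ r : 𝕜, P (algebraMap 𝕜 A r)) (hone : ∀ a ∈ 𝒜 1, P a)
    (hadd : ∀ a a', P a → P a' → P (a + a')) (hmul : ∀ a a', P a → P a' → P (a * a')) (a : A) :
    P a := by
  obtain ⟨t, rfl⟩ := hA a
  induction t using TensorAlgebra.induction with
  | algebraMap r => rw [AlgHom.commutes]; exact hscalar r
  | ι x => rw [canMap, TensorAlgebra.lift_ι_apply]; exact hone _ x.2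
  | mul x y hx hy => rw [map_mul]; exact hmul _ _ hx hy
  | add x y hx hy => rw [map_add]; exact hadd _ _ hx hy

theorem tensorWeight_one : tensorWeight 𝕜 W 1 = LinearMap.range (TensorAlgebra.ι 𝕜 (M := W)) := by
  rw [tensorWeight, pow_one]

theorem tensorWeight_zero : tensorWeight 𝕜 W 0 = 1 := by
  rw [tensorWeight, pow_zero]

/-- A family of elements of `A` moving past generators, up to elements of `A`, extends from degree
one to the whole of `A`. -/
theorem exists_mul_eq_add_sum [Fintype κ] [DecidableEq κ]
    (hA : Function.Surjective (canMap 𝕜 A 𝒜)) (α : A →ₐ[𝕜] C) (w : κ → C)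
    (h₁ : ∀ k, ∀ a ∈ 𝒜 1, ∃ (a₀ : A) (f : κ → A), w k * α a = α a₀ + ∑ l, α (f l) * w l)
    (k : κ) (a : A) : ∃ (a₀ : A) (f : κ → A), w k * α a = α a₀ + ∑ l, α (f l) * w l := by
  refine induction_of_surjective_canMap hA
    (P := fun a => ∀ k, ∃ (a₀ : A) (f : κ → A), w k * α a = α a₀ + ∑ l, α (f l) * w l)
    ?_ (fun a ha k => h₁ k a ha) ?_ ?_ a k
  · intro r k
    refine ⟨0, Pi.single k (algebraMap 𝕜 A r), ?_⟩
    rw [Finset.sum_eq_single k (fun l _ hl => by rw [Pi.single_eq_of_ne hl, map_zero, zero_mul])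
      (fun h => absurd (Finset.mem_univ k) h), Pi.single_eq_same, map_zero, zero_add,
      AlgHom.commutes, Algebra.commutes]
  · intro a a' h h' k
    obtain ⟨a₀, f, hf⟩ := h k
    obtain ⟨a₀', f', hf'⟩ := h' k
    refine ⟨a₀ + a₀', f + f', ?_⟩
    simp only [map_add, mul_add, hf, hf', Pi.add_apply, add_mul, Finset.sum_add_distrib]
    abel
  · intro a a' h h' k
    obtain ⟨a₀, f, hf⟩ := h k
    choose g₀ g hg using h'
    refine ⟨a₀ * a' + ∑ l, f l * g₀ l, fun m => ∑ l, f l * g l m, ?_⟩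
    rw [map_mul, ← mul_assoc, hf, add_mul, Finset.sum_mul, map_add, map_mul, add_assoc]
    congr 1
    simp only [mul_assoc, hg, mul_add, Finset.sum_add_distrib, map_sum, map_mul, Finset.mul_sum,
      Finset.sum_mul]
    congr 1
    exact Finset.sum_comm

/-- A family of generators whose left ideal absorbs right multiplication by degree one elements of
`A` spans a left ideal absorbing right multiplication by `A`. -/
theorem exists_mul_eq_sum [Fintype κ] [DecidableEq κ]
    (hA : Function.Surjective (canMap 𝕜 A 𝒜)) (α : A →ₐ[𝕜] C) (w : κ → C)
    (h₁ : ∀ k, ∀ a ∈ 𝒜 1, ∃ f : κ → C, w k * α a = ∑ l, f l * w l)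
    (k : κ) (a : A) : ∃ f : κ → C, w k * α a = ∑ l, f l * w l := by
  refine induction_of_surjective_canMap hA
    (P := fun a => ∀ k, ∃ f : κ → C, w k * α a = ∑ l, f l * w l)
    ?_ (fun a ha k => h₁ k a ha) ?_ ?_ a k
  · intro r k
    refine ⟨Pi.single k (algebraMap 𝕜 C r), ?_⟩
    rw [Finset.sum_eq_single k (fun l _ hl => by rw [Pi.single_eq_of_ne hl, zero_mul])
      (fun h => absurd (Finset.mem_univ k) h), Pi.single_eq_same,
      AlgHom.commutes, Algebra.commutes]
  · intro a a' h h' k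
    obtain ⟨f, hf⟩ := h k
    obtain ⟨f', hf'⟩ := h' k
    refine ⟨f + f', ?_⟩
    simp only [map_add, mul_add, hf, hf', Pi.add_apply, add_mul, Finset.sum_add_distrib]
  · intro a a' h h' k
    obtain ⟨f, hf⟩ := h k
    choose g hg using h'
    refine ⟨fun m => ∑ l, f l * g l m, ?_⟩
    rw [map_mul, ← mul_assoc, hf, Finset.sum_mul]
    simp only [mul_assoc, hg, Finset.mul_sum, Finset.sum_mul]
    exact Finset.sum_comm

theorem right_mul_left_mem (h : Realizes 𝕜 A (TensorAlgebra 𝕜 W) τ C ψ)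
    (hτ : IsTwisting 𝕜 A (TensorAlgebra 𝕜 W) τ) {B₁ : Submodule 𝕜 (TensorAlgebra 𝕜 W)}
    {S T : Submodule 𝕜 (A ⊗[𝕜] TensorAlgebra 𝕜 W)}
    (hsep : (subTmul 𝕜 B₁ (𝒜 1)).map τ ≤ S ⊔ T) {N : AddSubgroup C} (hS : ∀ x ∈ S, ψ x ∈ N)
    (hT : ∀ x ∈ T, ψ x ∈ N) {b : TensorAlgebra 𝕜 W} {a : A} (hb : b ∈ B₁) (ha : a ∈ 𝒜 1) :
    h.right hτ b * h.left hτ a ∈ N := by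
  rw [h.right_mul_left]
  obtain ⟨x, hx, y, hy, hxy⟩ := Submodule.mem_sup.1
    (hsep (Submodule.mem_map_of_mem (tmul_mem_subTmul hb ha)))
  rw [← hxy, map_add]
  exact add_mem (hS x hx) (hT y hy)

end Separable

section Construction

variable {𝕜 : Type} [Field 𝕜] {A : Type} [Ring A] [Algebra 𝕜 A] {𝒜 : ℕ → Submodule 𝕜 A}
  {W : Type} [AddCommGroup W] [Module 𝕜 W]
  {τ : TensorAlgebra 𝕜 W ⊗[𝕜] A →ₗ[𝕜] A ⊗[𝕜] TensorAlgebra 𝕜 W}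
  {C : Type} [Ring C] [Algebra 𝕜 C] {ψ : A ⊗[𝕜] TensorAlgebra 𝕜 W →ₗ[𝕜] C}
  {κ κ₁ κ₂ : Type}

/-- A basis adapted to a decomposition of the generating space of a tensor algebra. -/
theorem exists_basis_adapted [FiniteDimensional 𝕜 W] {B₁' B₁'' : Submodule 𝕜 (TensorAlgebra 𝕜 W)}
    (hsup : B₁' ⊔ B₁'' = tensorWeight 𝕜 W 1) (hinf : B₁' ⊓ B₁'' = ⊥) :
    ∃ (m n : ℕ) (b : Module.Basis (Fin m ⊕ Fin n) 𝕜 W),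
      B₁' = Submodule.span 𝕜 (Set.range fun k => TensorAlgebra.ι 𝕜 (b (.inl k))) ∧
      B₁'' = Submodule.span 𝕜 (Set.range fun k => TensorAlgebra.ι 𝕜 (b (.inr k))) := by
  rw [tensorWeight_one] at hsup
  have hι : Function.Injective (TensorAlgebra.ι 𝕜 (M := W)) :=
    TensorAlgebra.ι_leftInverse.injective
  have hle' : B₁' ≤ LinearMap.range (TensorAlgebra.ι 𝕜 (M := W)) := hsup ▸ le_sup_left
  have hle'' : B₁'' ≤ LinearMap.range (TensorAlgebra.ι 𝕜 (M := W)) := hsup ▸ le_sup_right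
  have hmap' := Submodule.map_comap_eq_of_le hle'
  have hmap'' := Submodule.map_comap_eq_of_le hle''
  have hc : IsCompl (B₁'.comap (TensorAlgebra.ι 𝕜)) (B₁''.comap (TensorAlgebra.ι 𝕜)) := by
    constructor
    · rw [disjoint_iff, ← Submodule.comap_inf, hinf, Submodule.comap_bot,
        LinearMap.ker_eq_bot.2 hι]
    · rw [codisjoint_iff]
      apply Submodule.map_injective_of_injective hι
      rw [Submodule.map_sup, hmap', hmap'', hsup, Submodule.map_top]
  have hspan : ∀ (V : Submodule 𝕜 W), Submodule.span 𝕜 (Set.range fun k =>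
      TensorAlgebra.ι 𝕜 (Module.finBasis 𝕜 V k : W)) = V.map (TensorAlgebra.ι 𝕜) := by
    intro V
    have := congrArg (Submodule.map ((TensorAlgebra.ι 𝕜) ∘ₗ V.subtype)) (Module.finBasis 𝕜 V).span_eq
    rw [Submodule.map_span, ← Set.range_comp, Submodule.map_comp, Submodule.map_top,
      Submodule.range_subtype] at this
    exact this
  refine ⟨_, _, ((Module.finBasis 𝕜 _).prod (Module.finBasis 𝕜 _)).map
    (Submodule.prodEquivOfIsCompl _ _ hc), ?_, ?_⟩
  · refine hmap'.symm.trans ((hspan _).symm.trans ?_)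
    simp
  · refine hmap''.symm.trans ((hspan _).symm.trans ?_)
    simp

namespace Realizes

section Coordinates

variable (h : Realizes 𝕜 A (TensorAlgebra 𝕜 W) τ C ψ)
  (hτ : IsTwisting 𝕜 A (TensorAlgebra 𝕜 W) τ) (b : Module.Basis κ 𝕜 W)

/-- The `A`-coordinate of an element of a twisted tensor product of `A` with `T(W)`. -/
def leftCoord : C →ₗ[𝕜] A :=
  (TensorProduct.rid 𝕜 A).toLinearMap ∘ₗ
    (LinearMap.fst 𝕜 𝕜 (κ → TensorAlgebra 𝕜 W) ∘ₗ coord b).lTensor A ∘ₗ h.equiv.symm.toLinearMap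

/-- The coordinates, along the basis vectors placed on the right, of an element of a twisted tensor
product of `A` with `T(W)`. -/
def genCoord (k : κ) : C →ₗ[𝕜] C :=
  ψ ∘ₗ (LinearMap.proj k ∘ₗ LinearMap.snd 𝕜 𝕜 (κ → TensorAlgebra 𝕜 W) ∘ₗ coord b).lTensor A ∘ₗ
    h.equiv.symm.toLinearMap

theorem leftCoord_apply (a : A) (t : TensorAlgebra 𝕜 W) :
    h.leftCoord b (h.left hτ a * h.right hτ t) = (coord b t).1 • a := by
  rw [left_mul_right]
  simp [leftCoord, h.equiv_symm_apply]

theorem genCoord_apply (k : κ) (a : A) (t : TensorAlgebra 𝕜 W) :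
    h.genCoord b k (h.left hτ a * h.right hτ t) = h.left hτ a * h.right hτ ((coord b t).2 k) := by
  rw [left_mul_right, left_mul_right]
  simp [genCoord, h.equiv_symm_apply]

theorem eq_leftCoord_add_sum [Fintype κ] [DecidableEq κ] (c : C) :
    c = h.left hτ (h.leftCoord b c) +
      ∑ k, h.genCoord b k c * h.right hτ (TensorAlgebra.ι 𝕜 (b k)) := by
  refine h.induction hτ (P := fun c => c = h.left hτ (h.leftCoord b c) +
      ∑ k, h.genCoord b k c * h.right hτ (TensorAlgebra.ι 𝕜 (b k))) (fun x y hx hy => ?_)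
    (fun a t => ?_) c
  · simp only [map_add, add_mul, Finset.sum_add_distrib]
    rw [add_add_add_comm, ← hx, ← hy]
  · simp only [h.leftCoord_apply hτ, h.genCoord_apply hτ]
    conv_lhs => rw [eq_coord b t]
    simp [mul_add, mul_assoc, Finset.mul_sum, Algebra.algebraMap_eq_smul_one]

theorem leftCoord_left (a : A) : h.leftCoord b (h.left hτ a) = a := by
  have := h.leftCoord_apply hτ b a (algebraMap 𝕜 _ 1)
  rw [coord_algebraMap] at this
  simpa using this

theorem genCoord_left (k : κ) (a : A) : h.genCoord b k (h.left hτ a) = 0 := by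
  have := h.genCoord_apply hτ b k a (algebraMap 𝕜 _ 1)
  rw [coord_algebraMap] at this
  simpa using this

theorem leftCoord_mul_gen [DecidableEq κ] (c : C) (k : κ) :
    h.leftCoord b (c * h.right hτ (TensorAlgebra.ι 𝕜 (b k))) = 0 := by
  refine h.induction hτ (P := fun c => h.leftCoord b (c * h.right hτ (TensorAlgebra.ι 𝕜 (b k))) = 0)
    (fun x y hx hy => by rw [add_mul, map_add, hx, hy, add_zero]) (fun a t => ?_) c
  rw [mul_assoc, ← map_mul, h.leftCoord_apply hτ, coord_mul_ι, zero_smul]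

theorem genCoord_mul_gen [DecidableEq κ] (k : κ) (c : C) (l : κ) :
    h.genCoord b k (c * h.right hτ (TensorAlgebra.ι 𝕜 (b l))) = if k = l then c else 0 := by
  refine h.induction hτ (P := fun c => h.genCoord b k (c * h.right hτ (TensorAlgebra.ι 𝕜 (b l))) =
    if k = l then c else 0) (fun x y hx hy => ?_) (fun a t => ?_) c
  · rw [add_mul, map_add, hx, hy]
    split_ifs <;> simp
  · rw [mul_assoc, ← map_mul, h.genCoord_apply hτ, coord_mul_ι]
    by_cases hkl : k = l <;> simp [hkl]

theorem induction_gen [Fintype κ] {P : C → Prop} (hadd : ∀ x y, P x → P y → P (x + y))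
    (hleft : ∀ a, P (h.left hτ a))
    (hmul : ∀ c k, P c → P (c * h.right hτ (TensorAlgebra.ι 𝕜 (b k)))) (c : C) : P c := by
  have hP : ∀ t c, (∀ r : 𝕜, P (r • c)) → ∀ r : 𝕜, P (r • (c * h.right hτ t)) := by
    intro t
    induction t using TensorAlgebra.induction with
    | algebraMap s =>
      intro c hc r
      rw [AlgHom.commutes, ← Algebra.commutes, ← Algebra.smul_def, smul_smul]
      exact hc _
    | ι w =>
      intro c hc r
      rw [← b.sum_repr w]
      simp only [map_sum, map_smul, Finset.mul_sum, Finset.smul_sum, mul_smul_comm, smul_smul]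
      refine Finset.sum_induction _ P hadd (by simpa using hleft 0) fun k _ => ?_
      rw [← smul_mul_assoc]
      exact hmul _ _ (hc _)
    | mul x y hx hy =>
      intro c hc
      rw [map_mul, ← mul_assoc]
      exact hy _ (hx _ hc)
    | add x y hx hy =>
      intro c hc r
      rw [map_add, mul_add, smul_add]
      exact hadd _ _ (hx c hc r) (hy c hc r)
  refine h.induction hτ hadd (fun a t => ?_) c
  rw [← one_smul 𝕜 (_ * _)]
  exact hP t _ (fun r => by rw [← map_smul]; exact hleft _) 1

end Coordinates

/-- A degree one generator of the first family moves past `A` up to an element of `A`. -/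
theorem exists_inl_mul [Fintype κ] [DecidableEq κ]
    (h : Realizes 𝕜 A (TensorAlgebra 𝕜 W) τ C ψ) (hτ : IsTwisting 𝕜 A (TensorAlgebra 𝕜 W) τ)
    (hA : Function.Surjective (canMap 𝕜 A 𝒜)) (v : κ → W)
    (hsep : (subTmul 𝕜 (Submodule.span 𝕜 (Set.range fun k => TensorAlgebra.ι 𝕜 (v k)))
      (𝒜 1)).map τ ≤ subTmul 𝕜 (𝒜 2) (tensorWeight 𝕜 W 0) ⊔
        subTmul 𝕜 (𝒜 1) (Submodule.span 𝕜 (Set.range fun k => TensorAlgebra.ι 𝕜 (v k))))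
    (k : κ) (a : A) : ∃ (a₀ : A) (f : κ → A), h.right hτ (TensorAlgebra.ι 𝕜 (v k)) * h.left hτ a =
      h.left hτ a₀ + ∑ l, h.left hτ (f l) * h.right hτ (TensorAlgebra.ι 𝕜 (v l)) := by
  refine exists_mul_eq_add_sum hA (h.left hτ) (fun k => h.right hτ (TensorAlgebra.ι 𝕜 (v k)))
    (fun k a ha => ?_) k a
  let N : Submodule 𝕜 C := LinearMap.range ((h.left hτ).toLinearMap.coprod
    (∑ l, LinearMap.mulRight 𝕜 (h.right hτ (TensorAlgebra.ι 𝕜 (v l))) ∘ₗ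
      (h.left hτ).toLinearMap ∘ₗ (LinearMap.proj l : (κ → A) →ₗ[𝕜] A)))
  have hN : h.right hτ (TensorAlgebra.ι 𝕜 (v k)) * h.left hτ a ∈ N.toAddSubgroup := by
    refine right_mul_left_mem h hτ hsep (fun x hx => ?_) (fun x hx => ?_)
      (Submodule.subset_span ⟨k, rfl⟩) ha
    · refine (map_subTmul_le fun a ha t ht => ?_ :
        (subTmul 𝕜 (𝒜 2) (tensorWeight 𝕜 W 0)).map ψ ≤ N) (Submodule.mem_map_of_mem hx)
      rw [tensorWeight_zero] at ht
      obtain ⟨r, rfl⟩ := Submodule.mem_one.1 ht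
      refine ⟨(r • a, 0), ?_⟩
      rw [← h.left_mul_right hτ]
      simp [Algebra.algebraMap_eq_smul_one]
    · refine (map_subTmul_le fun a ha t ht => ?_ : (subTmul 𝕜 (𝒜 1) _).map ψ ≤ N)
        (Submodule.mem_map_of_mem hx)
      suffices Submodule.span 𝕜 (Set.range fun k => TensorAlgebra.ι 𝕜 (v k)) ≤
        N.comap (ψ ∘ₗ TensorProduct.mk 𝕜 A _ a) from this ht
      rw [Submodule.span_le]
      rintro _ ⟨l, rfl⟩
      refine ⟨(0, Pi.single l a), ?_⟩
      rw [LinearMap.comp_apply, TensorProduct.mk_apply, ← h.left_mul_right hτ]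
      simp [Pi.single_apply, apply_ite]
  obtain ⟨⟨a₀, f⟩, hf⟩ := hN
  exact ⟨a₀, f, by rw [← hf]; simp⟩

/-- The left ideal generated by the second family absorbs right multiplication by `A`. -/
theorem exists_inr_mul [Fintype κ] [DecidableEq κ]
    (h : Realizes 𝕜 A (TensorAlgebra 𝕜 W) τ C ψ) (hτ : IsTwisting 𝕜 A (TensorAlgebra 𝕜 W) τ)
    (hA : Function.Surjective (canMap 𝕜 A 𝒜)) (v : κ → W)
    (hsep : (subTmul 𝕜 (Submodule.span 𝕜 (Set.range fun k => TensorAlgebra.ι 𝕜 (v k)))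
      (𝒜 1)).map τ ≤
        subTmul 𝕜 (𝒜 1) (Submodule.span 𝕜 (Set.range fun k => TensorAlgebra.ι 𝕜 (v k))) ⊔
        subTmul 𝕜 (𝒜 0) (tensorWeight 𝕜 W 1 *
          Submodule.span 𝕜 (Set.range fun k => TensorAlgebra.ι 𝕜 (v k))))
    (k : κ) (a : A) : ∃ f : κ → C, h.right hτ (TensorAlgebra.ι 𝕜 (v k)) * h.left hτ a =
      ∑ l, f l * h.right hτ (TensorAlgebra.ι 𝕜 (v l)) := by
  refine exists_mul_eq_sum hA (h.left hτ) (fun k => h.right hτ (TensorAlgebra.ι 𝕜 (v k)))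
    (fun k a ha => ?_) k a
  let N : Submodule 𝕜 C := LinearMap.range
    (∑ l, LinearMap.mulRight 𝕜 (h.right hτ (TensorAlgebra.ι 𝕜 (v l))) ∘ₗ
      (LinearMap.proj l : (κ → C) →ₗ[𝕜] C))
  have hmul : ∀ (c : C), ∀ t ∈ Submodule.span 𝕜 (Set.range fun k => TensorAlgebra.ι 𝕜 (v k)),
      c * h.right hτ t ∈ N := by
    intro c t ht
    suffices Submodule.span 𝕜 (Set.range fun k => TensorAlgebra.ι 𝕜 (v k)) ≤
      N.comap (LinearMap.mulLeft 𝕜 c ∘ₗ (h.right hτ).toLinearMap) from this ht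
    rw [Submodule.span_le]
    rintro _ ⟨l, rfl⟩
    exact ⟨Pi.single l c, by simp [Pi.single_apply, ite_mul]⟩
  have hN : h.right hτ (TensorAlgebra.ι 𝕜 (v k)) * h.left hτ a ∈ N.toAddSubgroup := by
    refine right_mul_left_mem h hτ hsep (fun x hx => ?_) (fun x hx => ?_)
      (Submodule.subset_span ⟨k, rfl⟩) ha
    · refine (map_subTmul_le fun a _ t ht => ?_ : (subTmul 𝕜 (𝒜 1) _).map ψ ≤ N)
        (Submodule.mem_map_of_mem hx)
      rw [← h.left_mul_right hτ]
      exact hmul _ _ ht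
    · refine (map_subTmul_le fun a _ t ht => ?_ : (subTmul 𝕜 (𝒜 0) _).map ψ ≤ N)
        (Submodule.mem_map_of_mem hx)
      rw [← h.left_mul_right hτ]
      induction ht using Submodule.mul_induction_on' with
      | mem_mul_mem s _ t ht => rw [map_mul, ← mul_assoc]; exact hmul _ _ ht
      | add s _ t _ hs ht => rw [map_add, mul_add]; exact add_mem hs ht
  obtain ⟨f, hf⟩ := hN
  exact ⟨f, by rw [← hf]; simp⟩

/-- A separable twisted tensor product with a tensor algebra, in coordinates. -/
def sepExt [GradedAlgebra 𝒜] [Fintype κ₁] [Fintype κ₂] [DecidableEq κ₁] [DecidableEq κ₂]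
    (h : Realizes 𝕜 A (TensorAlgebra 𝕜 W) τ C ψ) (hτ : IsTwisting 𝕜 A (TensorAlgebra 𝕜 W) τ)
    (hA : Function.Surjective (canMap 𝕜 A 𝒜)) (b : Module.Basis (κ₁ ⊕ κ₂) 𝕜 W)
    {B₁' B₁'' : Submodule 𝕜 (TensorAlgebra 𝕜 W)}
    (hB' : B₁' = Submodule.span 𝕜 (Set.range fun k => TensorAlgebra.ι 𝕜 (b (.inl k))))
    (hB'' : B₁'' = Submodule.span 𝕜 (Set.range fun k => TensorAlgebra.ι 𝕜 (b (.inr k))))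
    (hsep₁ : (subTmul 𝕜 B₁' (𝒜 1)).map τ ≤
      subTmul 𝕜 (𝒜 2) (tensorWeight 𝕜 W 0) ⊔ subTmul 𝕜 (𝒜 1) B₁')
    (hsep₂ : (subTmul 𝕜 B₁'' (𝒜 1)).map τ ≤
      subTmul 𝕜 (𝒜 1) B₁'' ⊔ subTmul 𝕜 (𝒜 0) (tensorWeight 𝕜 W 1 * B₁'')) :
    SepExt 𝒜 (fun n => (kunneth 𝕜 𝒜 (tensorWeight 𝕜 W) n).map ψ) κ₁ κ₂ where
  α := h.left hτ
  w k := h.right hτ (TensorAlgebra.ι 𝕜 (b k))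
  π := h.leftCoord b
  co := h.genCoord b
  α_mem n a ha := by
    simpa using left_mul_right_mem (ℬ := tensorWeight 𝕜 W) hτ h (add_zero n) ha
      (SetLike.one_mem_graded _)
  w_mem k := by
    have hk : TensorAlgebra.ι 𝕜 (b k) ∈ tensorWeight 𝕜 W 1 := by
      rw [tensorWeight_one]; exact LinearMap.mem_range_self _ _
    simpa using left_mul_right_mem (𝒜 := 𝒜) hτ h (zero_add 1) (SetLike.one_mem_graded 𝒜) hk
  expand := h.eq_leftCoord_add_sum hτ b
  π_α := h.leftCoord_left hτ b
  co_α := h.genCoord_left hτ b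
  π_mul := h.leftCoord_mul_gen hτ b
  co_mul := h.genCoord_mul_gen hτ b
  inl_mul := by
    subst hB'
    exact h.exists_inl_mul hτ hA (fun k => b (.inl k)) hsep₁
  inr_mul := by
    subst hB''
    exact h.exists_inr_mul hτ hA (fun k => b (.inr k)) hsep₂
  ind _ hadd hleft hmul := h.induction_gen hτ b hadd hleft hmul

end Realizes

end Construction

end TTP

namespace TTP

open TensorProduct LinearMap

/-- Corollary 5.11 (`free separable Koszul`).  Let `A` be a Koszul algebra with quadratic
relation space `I₂`, let `B = T(B₁)` be a free algebra generated in degree 1, and let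
`τ : B ⊗ A → A ⊗ B` be a separable graded twisting map such that
`π_{A₀⊗A₂⊗B₁}(1 ⊗ τ)(τ_B ⊗ 1)(B₁ ⊗ I₂) = 0`.  Then the twisted tensor product `A ⊗_τ B`
is Koszul.  (The twisted tensor product is encoded through realizations `(C, ψ)` of
`(A ⊗ B, μ_τ)`, with the transported Künneth grading.) -/
theorem stmt14 (𝕜 : Type) [Field 𝕜] (A : Type) [Ring A] [Algebra 𝕜 A]
    (𝒜 : ℕ → Submodule 𝕜 A) [GradedAlgebra 𝒜]
    (hconnA : 𝒜 0 = (1 : Submodule 𝕜 A))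
    (hquadA : IsQuadraticAlg 𝕜 A 𝒜) (hkoszulA : IsKoszul 𝕜 A 𝒜)
    (W : Type) [AddCommGroup W] [Module 𝕜 W] [FiniteDimensional 𝕜 W]
    (τ : (TensorAlgebra 𝕜 W) ⊗[𝕜] A →ₗ[𝕜] A ⊗[𝕜] (TensorAlgebra 𝕜 W))
    (hτ : IsGradedTwisting 𝕜 A (TensorAlgebra 𝕜 W) 𝒜 (tensorWeight 𝕜 W) τ)
    -- separability of `τ`, with respect to a decomposition `B₁ = B₁' ⊕ B₁''`:
    (B₁' B₁'' : Submodule 𝕜 (TensorAlgebra 𝕜 W))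
    (hdecsup : B₁' ⊔ B₁'' = tensorWeight 𝕜 W 1) (hdecinf : B₁' ⊓ B₁'' = ⊥)
    (hsep1 : Submodule.map τ (subTmul 𝕜 B₁' (𝒜 1)) ≤
      subTmul 𝕜 (𝒜 2) (tensorWeight 𝕜 W 0) ⊔ subTmul 𝕜 (𝒜 1) B₁')
    (hsep2 : Submodule.map τ (subTmul 𝕜 B₁'' (𝒜 1)) ≤
      subTmul 𝕜 (𝒜 1) B₁'' ⊔ subTmul 𝕜 (𝒜 0) (tensorWeight 𝕜 W 1 * B₁''))
    -- the condition `π_{A₀⊗A₂⊗B₁} (1 ⊗ τ)(τ_B ⊗ 1) (B₁ ⊗ I₂) = 0`: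
    (hcond : ∀ x ∈ subTmul 𝕜 (tensorWeight 𝕜 W 1)
        (LinearMap.ker (LinearMap.mul' 𝕜 A) ⊓ subTmul 𝕜 (𝒜 1) (𝒜 1)),
      (TensorProduct.map (GradedAlgebra.proj 𝒜 0)
          (TensorProduct.map (GradedAlgebra.proj 𝒜 2)
            (GradedAlgebra.proj (tensorWeight 𝕜 W) 1)))
        ((lTensor A τ
          ∘ₗ (TensorProduct.assoc 𝕜 A (TensorAlgebra 𝕜 W) A).toLinearMap
          ∘ₗ rTensor A (TensorProduct.map (GradedAlgebra.proj 𝒜 0)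
              (GradedAlgebra.proj (tensorWeight 𝕜 W) 2) ∘ₗ τ)
          ∘ₗ (TensorProduct.assoc 𝕜 (TensorAlgebra 𝕜 W) A A).symm.toLinearMap) x) = 0) :
    ∀ (C : Type) [Ring C] [Algebra 𝕜 C],
      ∀ ψ : A ⊗[𝕜] (TensorAlgebra 𝕜 W) →ₗ[𝕜] C,
        Realizes 𝕜 A (TensorAlgebra 𝕜 W) τ C ψ →
        IsKoszul 𝕜 C (fun n => Submodule.map ψ (kunneth 𝕜 𝒜 (tensorWeight 𝕜 W) n)) := by
  intro C _ _ ψ h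
  let := gradedAlgebraOfRealizes 𝒜 (tensorWeight 𝕜 W) hτ h
  obtain ⟨m, n, b, hB', hB''⟩ := exists_basis_adapted hdecsup hdecinf
  exact (h.sepExt hτ.1 hquadA.1 b hB' hB'' hsep1 hsep2).isKoszul hkoszulA

end TTP
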